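/- arXiv:1405.5188 — 6 statements merged into one kernel-verified Lean document; each statement's English description precedes it below -/
import Mathlib

section
/- Let R = k[[x,y]]/(xy) with k a field, M = k the residue field, and N = R/(x+y). Then pd_R(N) = 1, pd_R(M) = ∞, and Ext^i_R(M,N) = 0 for all i ≥ 2. In particular N is Tor-rigid (as pd(N) is finite over a local ring of depth 1) but N is not a test module. -/
open CategoryTheory

noncomputable section

variable (R : Type) [CommRing R]

/-- `Ext^n_R(M,N)` as an `R`-module object. -/
abbrev ext (n : ℕ) (M N : ModuleCat R) : ModuleCat R :=
  ((Ext R (ModuleCat R) n).obj (Opposite.op M)).obj N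

/-- `Tor_n^R(M,N)`. -/
abbrev tor (n : ℕ) (M N : ModuleCat R) : ModuleCat R :=
  ((Tor (ModuleCat R) n).obj M).obj N

/-- projective dimension, via vanishing of `Ext` in degrees above `n`. -/
def projDim (M : ModuleCat R) : ℕ∞ :=
  sInf {n : ℕ∞ | ∀ (i : ℕ) (X : ModuleCat R), n < i → Subsingleton (ext R i M X)}

/-- injective dimension, via vanishing of `Ext` in degrees above `n`. -/
def injDim (N : ModuleCat R) : ℕ∞ :=
  sInf {n : ℕ∞ | ∀ (i : ℕ) (X : ModuleCat R), n < i → Subsingleton (ext R i X N)}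

/-- depth over a local ring, as the least `n` with `Ext^n(k, N) ≠ 0`. -/
def depth [IsLocalRing R] (N : ModuleCat R) : ℕ∞ :=
  sInf {n : ℕ∞ | ∃ i : ℕ, n = i ∧
    ¬ Subsingleton (ext R i (ModuleCat.of R (IsLocalRing.ResidueField R)) N)}

/-- Tor-rigidity. -/
def TorRigid (N : ModuleCat R) : Prop :=
  ∀ (X : ModuleCat R), Module.Finite R X → ∀ n : ℕ, 1 ≤ n →
    Subsingleton (tor R n N X) → Subsingleton (tor R (n + 1) N X)

/-- test module for projectivity. -/
def TestModule (M : ModuleCat R) : Prop :=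
  ∀ (X : ModuleCat R), Module.Finite R X → projDim R X = ⊤ →
    {j : ℕ | ¬ Subsingleton (tor R j M X)}.Infinite

/-- strongly-rigid module. -/
def StronglyRigid (N : ModuleCat R) : Prop :=
  ∀ (X : ModuleCat R), Module.Finite R X → ∀ n : ℕ, 1 ≤ n →
    Subsingleton (tor R n N X) → projDim R X < ⊤

/-- rigid-test module. -/
def RigidTest (N : ModuleCat R) : Prop :=
  ∀ (X : ModuleCat R), Module.Finite R X → ∀ n : ℕ, 1 ≤ n →
    Subsingleton (tor R n N X) →
      Subsingleton (tor R (n + 1) N X) ∧ projDim R X < ⊤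


/-- the ring `R = k[[x,y]]/(xy)`. -/
abbrev Rxy (k : Type) [Field k] : Type :=
  MvPowerSeries (Fin 2) k ⧸
    (Ideal.span {(MvPowerSeries.X 0 : MvPowerSeries (Fin 2) k) * MvPowerSeries.X 1})

/-- the class of `x` in `R = k[[x,y]]/(xy)`. -/
noncomputable abbrev xcl (k : Type) [Field k] : Rxy k :=
  Ideal.Quotient.mk _ (MvPowerSeries.X 0)

/-- the class of `y` in `R = k[[x,y]]/(xy)`. -/
noncomputable abbrev ycl (k : Type) [Field k] : Rxy k :=
  Ideal.Quotient.mk _ (MvPowerSeries.X 1)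

namespace Pf
open Limits MonoidalCategory

section
variable {R}

/-- chain complex from a sequence of maps. -/
def cx (P : ℕ → ModuleCat.{0} R) (d : ∀ n, P (n+1) ⟶ P n) (hd : ∀ n, d (n+1) ≫ d n = 0) :
    ChainComplex (ModuleCat.{0} R) ℕ := ChainComplex.of P d hd

lemma cx_d (P : ℕ → ModuleCat.{0} R) (d : ∀ n, P (n+1) ⟶ P n) (hd : ∀ n, d (n+1) ≫ d n = 0)
    (n : ℕ) : (cx P d hd).d (n+1) n = d n := ChainComplex.of_d _ _ _

/-- resolution from exactness data. -/
def res (P : ℕ → ModuleCat.{0} R) (d : ∀ n, P (n+1) ⟶ P n) (hd : ∀ n, d (n+1) ≫ d n = 0)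
    (hP : ∀ n, Projective (P n)) (M : ModuleCat.{0} R) (e : P 0 ⟶ M) (he : Function.Surjective e)
    (h0 : d 0 ≫ e = 0) (hex0 : ∀ x, e x = 0 → ∃ y, d 0 y = x)
    (hex : ∀ n x, d n x = 0 → ∃ y, d (n+1) y = x) : ProjectiveResolution M where
  complex := cx P d hd
  projective n := hP n
  π := (ChainComplex.toSingle₀Equiv _ _).symm ⟨e, by rw [cx_d]; exact h0⟩
  quasiIso := ⟨fun n => by
    cases n with
    | zero =>
      rw [ChainComplex.quasiIsoAt₀_iff, ShortComplex.quasiIso_iff_of_zeros' _ rfl rfl rfl]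
      refine (ShortComplex.exact_and_epi_g_iff_of_iso (S₂ := ShortComplex.mk (d 0) e h0) ?_).2 ⟨?_, ?_⟩
      · exact ShortComplex.isoMk (Iso.refl _) (Iso.refl _) (Iso.refl _)
          (by simp; exact (cx_d P d hd 0).symm) (by simp; rfl)
      · rw [ShortComplex.moduleCat_exact_iff]; exact hex0
      · exact (ModuleCat.epi_iff_surjective _).2 he
    | succ m =>
      rw [quasiIsoAt_iff_exactAt' (hL := ChainComplex.exactAt_succ_single_obj ..),
          HomologicalComplex.exactAt_iff' _ (m + 2) (m + 1) m (by simp) (by simp),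
          ShortComplex.moduleCat_exact_iff]
      intro x hx
      obtain ⟨y, hy⟩ := hex m x (by rw [← cx_d P d hd]; exact hx)
      exact ⟨y, by rw [← hy, ← cx_d P d hd]; rfl⟩⟩

lemma ext_iff (P : ℕ → ModuleCat.{0} R) (d : ∀ n, P (n+1) ⟶ P n) (hd : ∀ n, d (n+1) ≫ d n = 0)
    (hP : ∀ n, Projective (P n)) (M : ModuleCat.{0} R) (e : P 0 ⟶ M) (he : Function.Surjective e)
    (h0 : d 0 ≫ e = 0) (hex0 : ∀ x, e x = 0 → ∃ y, d 0 y = x)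
    (hex : ∀ n x, d n x = 0 → ∃ y, d (n+1) y = x) (Y : ModuleCat.{0} R) (n : ℕ) :
    Subsingleton (ext R (n+1) M Y) ↔
      ∀ f : P (n+1) ⟶ Y, d (n+1) ≫ f = 0 → ∃ g : P n ⟶ Y, d n ≫ g = f := by
  rw [← ModuleCat.isZero_iff_subsingleton,
    ((res P d hd hP M e he h0 hex0 hex).isoExt (R := R) (n+1) Y).isZero_iff,
    ← HomologicalComplex.exactAt_iff_isZero_homology,
    HomologicalComplex.exactAt_iff' _ n (n+1) (n+2) (by simp) (by simp),
    ShortComplex.moduleCat_exact_iff]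
  have key : ∀ m (g : P m ⟶ Y),
    (((res P d hd hP M e he h0 hex0 hex).complex.linearYonedaObj R Y).d m (m+1)) g = d m ≫ g := by
    intro m g
    rw [← cx_d P d hd]
    rfl
  constructor
  · intro h f hf
    obtain ⟨g, hg⟩ := h f ((key _ _).trans hf)
    exact ⟨g, (key _ _).symm.trans hg⟩
  · intro h f hf
    obtain ⟨g, hg⟩ := h f ((key _ _).symm.trans hf)
    exact ⟨g, (key _ _).trans hg⟩

lemma tens_surj (s : R) (P : Type) [AddCommGroup P] [Module R P]
    (z : TensorProduct R (R ⧸ Ideal.span {s}) P) :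
    ∃ p : P, z = TensorProduct.tmul R (1 : R ⧸ Ideal.span {s}) p := by
  induction z with
  | zero => exact ⟨0, by simp⟩
  | add a b ha hb =>
    obtain ⟨p, rfl⟩ := ha
    obtain ⟨q, rfl⟩ := hb
    exact ⟨p + q, by rw [TensorProduct.tmul_add]⟩
  | tmul a p =>
    obtain ⟨r, rfl⟩ := Ideal.Quotient.mk_surjective a
    refine ⟨r • p, ?_⟩
    rw [← TensorProduct.smul_tmul]
    congr 1
    rw [Algebra.smul_def, mul_one]; rfl

lemma tens_zero (s : R) (P : Type) [AddCommGroup P] [Module R P] (p : P) :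
    TensorProduct.tmul R (1 : R ⧸ Ideal.span {s}) p = 0 ↔ ∃ q, p = s • q := by
  constructor
  · intro h
    have := congrArg (TensorProduct.quotTensorEquivQuotSMul P (Ideal.span {s})) h
    rw [map_zero] at this
    have h2 : TensorProduct.quotTensorEquivQuotSMul P (Ideal.span {s})
      (TensorProduct.tmul R (1 : R ⧸ Ideal.span {s}) p) = Submodule.Quotient.mk p := by
      simp
    rw [h2, Submodule.Quotient.mk_eq_zero, Submodule.ideal_span_singleton_smul,
      Submodule.mem_smul_pointwise_iff_exists] at this
    obtain ⟨q, -, hq⟩ := this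
    exact ⟨q, hq.symm⟩
  · rintro ⟨q, rfl⟩
    rw [← TensorProduct.smul_tmul]
    have : s • (1 : R ⧸ Ideal.span {s}) = 0 := by
      rw [Algebra.smul_def, mul_one]
      exact Ideal.Quotient.eq_zero_iff_mem.2 (Ideal.mem_span_singleton_self s)
    rw [this, TensorProduct.zero_tmul]

lemma reg_proj (s : R) (hs : ∀ r, s * r = 0 → r = 0) (P : Type) [AddCommGroup P] [Module R P]
    [Module.Projective R P] (p : P) (h : s • p = 0) : p = 0 := by
  obtain ⟨f, hf⟩ := Module.projective_lifting_property
    (Finsupp.linearCombination R (id : P → P)) LinearMap.id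
    (Finsupp.linearCombination_id_surjective R P)
  have h1 : f p = 0 := by
    have : s • f p = 0 := by rw [← map_smul, h, map_zero]
    ext i
    exact hs _ (by simpa using DFunLike.congr_fun this i)
  have := LinearMap.congr_fun hf p
  simpa [h1] using this.symm

lemma tor_vanish (s : R) (hs : ∀ r, s * r = 0 → r = 0) (X : ModuleCat.{0} R) (n : ℕ) :
    Subsingleton (tor R (n+2) (ModuleCat.of R (R ⧸ Ideal.span {s})) X) := by
  let P := ProjectiveResolution.of X
  have hproj : ∀ i, Module.Projective R (P.complex.X i) := fun i =>
    (IsProjective.iff_projective _).2 (P.projective i)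
  have hexP : ∀ i (x : P.complex.X (i+1)), P.complex.d (i+1) i x = 0 →
      ∃ y, P.complex.d (i+2) (i+1) y = x := fun i =>
    (ShortComplex.moduleCat_exact_iff _).1 (P.exact_succ i)
  have hdd : ∀ i (x : P.complex.X (i+2)), P.complex.d (i+1) i (P.complex.d (i+2) (i+1) x) = 0 := by
    intro i x
    rw [← ModuleCat.comp_apply, P.complex.d_comp_d]; rfl
  change Subsingleton (((((tensoringLeft (ModuleCat.{0} R)).obj
    (ModuleCat.of R (R ⧸ Ideal.span {s}))).leftDerived (n+2)).obj X : ModuleCat R))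
  rw [← ModuleCat.isZero_iff_subsingleton, (P.isoLeftDerivedObj _ (n+2)).isZero_iff]
  change IsZero (HomologicalComplex.homology _ _)
  rw [← HomologicalComplex.exactAt_iff_isZero_homology,
    HomologicalComplex.exactAt_iff' _ (n+3) (n+2) (n+1) (by simp) (by simp),
    ShortComplex.moduleCat_exact_iff]
  intro z hz
  obtain ⟨p, hp⟩ := tens_surj s (P.complex.X (n+2)) z
  have h1 : TensorProduct.tmul R (1 : R ⧸ Ideal.span {s}) (P.complex.d (n+2) (n+1) p) = 0 := by
    rw [hp] at hz
    exact hz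
  obtain ⟨w, hw⟩ := (tens_zero s _ _).1 h1
  have hw0 : P.complex.d (n+1) n w = 0 := by
    apply reg_proj s hs
    rw [← map_smul, ← hw]; exact hdd _ _
  obtain ⟨v, hv⟩ := hexP _ _ hw0
  obtain ⟨u, hu⟩ := hexP (n+1) (p - s • v) (by rw [map_sub, map_smul, hv, hw, sub_self])
  refine ⟨TensorProduct.tmul R (1 : R ⧸ Ideal.span {s}) u, ?_⟩
  rw [hp]
  change TensorProduct.tmul R (1 : R ⧸ Ideal.span {s}) (P.complex.d (n+3) (n+2) u) = _
  rw [hu, TensorProduct.tmul_sub, (tens_zero s _ (s • v)).2 ⟨v, rfl⟩, sub_zero]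

end

section
variable {R}

/-- terms of the resolution of `R/(s)`. -/
def PN (R : Type) [CommRing R] : ℕ → ModuleCat.{0} R
  | 0 => ModuleCat.of R R
  | 1 => ModuleCat.of R R
  | _ + 2 => ModuleCat.of R PUnit

/-- differentials of the resolution of `R/(s)`. -/
def dN (s : R) : ∀ n, PN R (n+1) ⟶ PN R n
  | 0 => ModuleCat.ofHom (LinearMap.mulLeft R s)
  | _ + 1 => 0

lemma extN (s : R) (hs : ∀ r, s * r = 0 → r = 0) (Y : ModuleCat.{0} R) (n : ℕ) :
    Subsingleton (ext R (n+1) (ModuleCat.of R (R ⧸ Ideal.span {s})) Y) ↔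
      ∀ f : PN R (n+1) ⟶ Y, dN s (n+1) ≫ f = 0 → ∃ g : PN R n ⟶ Y, dN s n ≫ g = f := by
  refine ext_iff (PN R) (dN s) (fun n => ?_) (fun n => ?_) _
    (ModuleCat.ofHom (Submodule.mkQ (Ideal.span {s}))) (Submodule.mkQ_surjective _)
    ?_ ?_ ?_ Y n
  · simp [dN]
  · rcases n with _ | _ | n
    · exact (IsProjective.iff_projective _).1 (inferInstanceAs (Module.Projective R R))
    · exact (IsProjective.iff_projective _).1 (inferInstanceAs (Module.Projective R R))
    · exact (IsProjective.iff_projective _).1 (inferInstanceAs (Module.Projective R PUnit))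
  · apply ModuleCat.hom_ext
    refine LinearMap.ext ?_
    intro (x : R)
    refine (Submodule.Quotient.mk_eq_zero (Ideal.span {s}) (x := s * x)).2 ?_
    exact Ideal.mul_mem_right _ _ (Ideal.mem_span_singleton_self s)
  · intro (x : R) hx
    change Submodule.Quotient.mk x = _ at hx
    rw [Submodule.Quotient.mk_eq_zero, Ideal.mem_span_singleton'] at hx
    obtain ⟨a, ha⟩ := hx
    exact ⟨a, (mul_comm s a).trans ha⟩
  · intro n x hx
    rcases n with _ | n
    · exact ⟨0, (map_zero _).trans (hs x hx).symm⟩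
    · exact ⟨0, rfl⟩

/-- terms of the resolution of `R/(x,y)`. -/
def PK (R : Type) [CommRing R] : ℕ → ModuleCat.{0} R
  | 0 => ModuleCat.of R R
  | _ + 1 => ModuleCat.of R (R × R)

/-- `(a,b) ↦ xa + yb`. -/
def dK0 (x y : R) : R × R →ₗ[R] R := (LinearMap.mulLeft R x).coprod (LinearMap.mulLeft R y)

/-- `(a,b) ↦ (yb, xa)`. -/
def dK1 (x y : R) : R × R →ₗ[R] R × R :=
  ((LinearMap.mulLeft R y).comp (LinearMap.snd R R R)).prod
    ((LinearMap.mulLeft R x).comp (LinearMap.fst R R R))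

/-- differentials of the resolution of `R/(x,y)`. -/
def dK (x y : R) : ∀ n, PK R (n+1) ⟶ PK R n
  | 0 => ModuleCat.ofHom (dK0 x y)
  | _ + 1 => ModuleCat.ofHom (dK1 x y)

lemma dK0_apply (x y : R) (a b : R) : dK0 x y (a, b) = x * a + y * b := rfl
lemma dK1_apply (x y : R) (a b : R) : dK1 x y (a, b) = (y * b, x * a) := rfl

lemma extK (x y : R) (hxy : x * y = 0) (hx : ∀ a, x * a = 0 → ∃ b, a = y * b)
    (hy : ∀ a, y * a = 0 → ∃ b, a = x * b) (hi : ∀ a b, x * a = y * b → x * a = 0)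
    (Y : ModuleCat.{0} R) (n : ℕ) :
    Subsingleton (ext R (n+2) (ModuleCat.of R (R ⧸ Ideal.span {x, y})) Y) ↔
      ∀ f : R × R →ₗ[R] Y, f ∘ₗ dK1 x y = 0 → ∃ g : R × R →ₗ[R] Y, g ∘ₗ dK1 x y = f := by
  have := ext_iff (PK R) (dK x y) (fun n => ?_) (fun n => ?_)
    (ModuleCat.of R (R ⧸ Ideal.span {x, y}))
    (ModuleCat.ofHom (Submodule.mkQ (Ideal.span {x, y}))) (Submodule.mkQ_surjective _)
    ?_ ?_ ?_ Y (n+1)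
  · rw [this]
    constructor
    · intro h f hf
      obtain ⟨g, hg⟩ := h (ModuleCat.ofHom f) (by
        change ModuleCat.ofHom (f ∘ₗ dK1 x y) = 0
        rw [hf]; rfl)
      exact ⟨g.hom, congrArg ModuleCat.Hom.hom hg⟩
    · intro h f hf
      obtain ⟨g, hg⟩ := h f.hom (congrArg ModuleCat.Hom.hom hf)
      exact ⟨ModuleCat.ofHom g, ModuleCat.hom_ext hg⟩
  · rcases n with _ | n
    · apply ModuleCat.hom_ext
      refine LinearMap.ext ?_
      rintro ⟨a, b⟩
      change x * (y * b) + y * (x * a) = 0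
      linear_combination (a + b) * hxy
    · apply ModuleCat.hom_ext
      refine LinearMap.ext ?_
      rintro ⟨a, b⟩
      change (y * (x * a), x * (y * b)) = (0 : R × R)
      ext
      · change _ = (0 : R)
        linear_combination a * hxy
      · change _ = (0 : R)
        linear_combination b * hxy
  · rcases n with _ | n
    · exact (IsProjective.iff_projective _).1 (inferInstanceAs (Module.Projective R R))
    · exact (IsProjective.iff_projective _).1 (inferInstanceAs (Module.Projective R (R × R)))
  · apply ModuleCat.hom_ext
    refine LinearMap.ext ?_
    rintro ⟨a, b⟩
    refine (Submodule.Quotient.mk_eq_zero (Ideal.span {x, y}) (x := x * a + y * b)).2 ?_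
    exact Ideal.add_mem _ (Ideal.mul_mem_right _ _ (Ideal.subset_span (by simp)))
      (Ideal.mul_mem_right _ _ (Ideal.subset_span (by simp)))
  · intro (z : R) hz
    change Submodule.Quotient.mk z = _ at hz
    rw [Submodule.Quotient.mk_eq_zero, Ideal.mem_span_pair] at hz
    obtain ⟨a, b, h⟩ := hz
    refine ⟨((a, b) : R × R), ?_⟩
    change x * a + y * b = z
    rw [← h]; ring
  · intro n z hz
    rcases n with _ | n
    · obtain ⟨a, b⟩ : R × R := z
      change x * a + y * b = 0 at hz
      have h1 : x * a = 0 := hi a (-b) (by linear_combination hz)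
      obtain ⟨g, rfl⟩ := hx a h1
      obtain ⟨h, rfl⟩ := hy b (by rw [h1, zero_add] at hz; exact hz)
      exact ⟨((h, g) : R × R), rfl⟩
    · obtain ⟨a, b⟩ : R × R := z
      change (y * b, x * a) = (0 : R × R) at hz
      obtain ⟨g, rfl⟩ := hx a (congrArg Prod.snd hz)
      obtain ⟨h, rfl⟩ := hy b (congrArg Prod.fst hz)
      exact ⟨((h, g) : R × R), rfl⟩

lemma quot_ker (x y : R) (hx : ∀ a, x * a = 0 → ∃ b, a = y * b)
    (hy : ∀ a, y * a = 0 → ∃ b, a = x * b) (hi : ∀ a b, x * a = y * b → x * a = 0)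
    (q : R ⧸ Ideal.span {x + y}) (h : y • q = 0) : ∃ p, q = x • p := by
  obtain ⟨a, rfl⟩ := Submodule.Quotient.mk_surjective _ q
  rw [← Submodule.Quotient.mk_smul, Submodule.Quotient.mk_eq_zero, smul_eq_mul,
    Ideal.mem_span_singleton'] at h
  obtain ⟨b, hb⟩ := h
  have h1 : x * b = y * (a - b) := by linear_combination hb
  have h2 := hi _ _ h1
  obtain ⟨b', rfl⟩ := hx b h2
  obtain ⟨c, hc⟩ := hy _ (h1.symm.trans h2)
  refine ⟨Submodule.Quotient.mk (c - b'), ?_⟩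
  rw [← Submodule.Quotient.mk_smul, Submodule.Quotient.eq, Ideal.mem_span_singleton']
  exact ⟨b', by rw [smul_eq_mul]; linear_combination -hc⟩

theorem main (x y : R) (hxy : x * y = 0) (hx : ∀ a, x * a = 0 → ∃ b, a = y * b)
    (hy : ∀ a, y * a = 0 → ∃ b, a = x * b) (hi : ∀ a b, x * a = y * b → x * a = 0)
    (h1 : (1 : R) ∉ Ideal.span {x, y}) :
    projDim R (ModuleCat.of R (R ⧸ Ideal.span {x + y})) = 1 ∧
    projDim R (ModuleCat.of R (R ⧸ Ideal.span {x, y})) = ⊤ ∧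
    (∀ i : ℕ, 2 ≤ i → Subsingleton
      (ext R i (ModuleCat.of R (R ⧸ Ideal.span {x, y}))
        (ModuleCat.of R (R ⧸ Ideal.span {x + y})))) ∧
    TorRigid R (ModuleCat.of R (R ⧸ Ideal.span {x + y})) ∧
    ¬ TestModule R (ModuleCat.of R (R ⧸ Ideal.span {x + y})) := by
  have hs : ∀ r, (x + y) * r = 0 → r = 0 := by
    intro r hr
    have h2 : x * r = 0 := hi r (-r) (by linear_combination hr)
    have h3 : y * r = 0 := by linear_combination hr - h2
    obtain ⟨b, rfl⟩ := hx r h2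
    obtain ⟨c, hc⟩ := hy _ h3
    rw [hc]
    exact hi _ _ hc.symm
  have hs1 : (1 : R) ∉ Ideal.span {x + y} := by
    intro h
    apply h1
    rw [Ideal.mem_span_singleton'] at h
    obtain ⟨a, ha⟩ := h
    rw [Ideal.mem_span_pair]
    exact ⟨a, a, by rw [← ha]; ring⟩
  have htop : projDim R (ModuleCat.of R (R ⧸ Ideal.span {x, y})) = ⊤ := by
    rw [projDim, sInf_eq_top]
    intro b hb
    by_contra hne
    obtain ⟨m, rfl⟩ := ENat.ne_top_iff_exists.1 hne
    have h2 := hb (m+2) (ModuleCat.of R (R ⧸ Ideal.span {x, y}))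
      (by exact_mod_cast (by omega : m < m + 2))
    rw [extK x y hxy hx hy hi] at h2
    have hkill : ∀ q : R ⧸ Ideal.span {x, y}, x • q = 0 := by
      intro q
      obtain ⟨a, rfl⟩ := Submodule.Quotient.mk_surjective _ q
      rw [← Submodule.Quotient.mk_smul, Submodule.Quotient.mk_eq_zero]
      exact Ideal.mul_mem_right _ _ (Ideal.subset_span (by simp))
    obtain ⟨g, hg⟩ := h2 (Submodule.mkQ (Ideal.span {x, y}) ∘ₗ LinearMap.fst R R R) (by
      refine LinearMap.ext ?_
      rintro ⟨a, b⟩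
      refine (Submodule.Quotient.mk_eq_zero (Ideal.span {x, y}) (x := y * b)).2 ?_
      exact Ideal.mul_mem_right _ _ (Ideal.subset_span (by simp)))
    have h3 := LinearMap.congr_fun hg (1, 0)
    rw [LinearMap.comp_apply, dK1_apply] at h3
    have h4 : ((y * 0, x * 1) : R × R) = x • (0, 1) := by simp
    rw [h4, map_smul] at h3
    have h5 : Submodule.Quotient.mk (p := Ideal.span {x, y}) (1 : R) = 0 :=
      h3.symm.trans (hkill _)
    rw [Submodule.Quotient.mk_eq_zero] at h5
    exact h1 h5
  refine ⟨?_, htop, ?_, ?_, ?_⟩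
  · apply le_antisymm
    · apply sInf_le
      intro i X hiX
      have : 1 < i := by exact_mod_cast hiX
      obtain ⟨n, rfl⟩ := Nat.exists_eq_add_of_lt this
      rw [show 1 + n + 1 = (n + 1) + 1 by ring, extN _ hs]
      intro f _
      refine ⟨0, ?_⟩
      apply ModuleCat.hom_ext
      refine LinearMap.ext ?_
      intro z
      exact (map_zero f.hom).symm
    · apply le_sInf
      intro b hb
      by_contra hlt
      have h2 := hb 1 (ModuleCat.of R (R ⧸ Ideal.span {x + y}))
        (by exact_mod_cast not_le.1 hlt)
      rw [extN _ hs _ 0] at h2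
      obtain ⟨g, hg⟩ := h2 (ModuleCat.ofHom (Submodule.mkQ (Ideal.span {x + y}))) zero_comp
      have h3 : g.hom ((x + y) * (1 : R) : R) = Submodule.Quotient.mk (1 : R) :=
        LinearMap.congr_fun (congrArg ModuleCat.Hom.hom hg) (1 : R)
      have h4 : g.hom ((x + y) * (1 : R) : R) = (x + y) • g.hom (1 : R) :=
        map_smul g.hom (x + y) (1 : R)
      obtain ⟨a, ha⟩ := Submodule.Quotient.mk_surjective _ (g.hom (1 : R))
      rw [h4, ← ha, ← Submodule.Quotient.mk_smul] at h3
      have h5 := (Submodule.Quotient.mk_eq_zero (Ideal.span {x + y})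
        (x := (x + y) • a)).2 (Ideal.mul_mem_right _ _ (Ideal.mem_span_singleton_self _))
      rw [h5] at h3
      exact hs1 ((Submodule.Quotient.mk_eq_zero _).1 h3.symm)
  · intro i hi2
    obtain ⟨n, rfl⟩ := Nat.exists_eq_add_of_le' hi2
    rw [extK x y hxy hx hy hi]
    intro f hf
    have e1 : y • f (1, 0) = 0 := by
      have := LinearMap.congr_fun hf (0, 1)
      rw [LinearMap.comp_apply, dK1_apply] at this
      rw [← map_smul]; simpa using this
    have e2 : x • f (0, 1) = 0 := by
      have := LinearMap.congr_fun hf (1, 0)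
      rw [LinearMap.comp_apply, dK1_apply] at this
      rw [← map_smul]; simpa using this
    obtain ⟨p, hp⟩ := quot_ker x y hx hy hi _ e1
    have hi' : ∀ a b, y * a = x * b → y * a = 0 := fun a b h => h.trans (hi b a h.symm)
    obtain ⟨q, hq⟩ : ∃ q, f (0, 1) = y • q := by
      have := quot_ker y x hy hx hi'
      rw [add_comm y x] at this
      exact this _ e2
    refine ⟨(LinearMap.toSpanSingleton R _ q).coprod (LinearMap.toSpanSingleton R _ p), ?_⟩
    refine LinearMap.ext ?_
    rintro ⟨a, b⟩
    have h3 : ((a, b) : R × R) = a • (1, 0) + b • (0, 1) := by simp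
    have h4 : f (a, b) = a • x • p + b • y • q := by
      rw [h3, map_add, map_smul, map_smul, hp, hq]
    rw [h4, LinearMap.comp_apply, dK1_apply, LinearMap.coprod_apply,
      LinearMap.toSpanSingleton_apply, LinearMap.toSpanSingleton_apply, smul_smul, smul_smul,
      mul_comm y, mul_comm x]
    exact add_comm _ _
  · intro X _ n hn _
    obtain ⟨m, rfl⟩ := Nat.exists_eq_add_of_le' hn
    exact tor_vanish _ hs X m
  · intro h
    refine h (ModuleCat.of R (R ⧸ Ideal.span {x, y}))
      (inferInstanceAs (Module.Finite R (R ⧸ Ideal.span {x, y}))) htop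
      ((Set.finite_lt_nat 2).subset ?_)
    intro j hj
    by_contra hlt
    obtain ⟨m, rfl⟩ := Nat.exists_eq_add_of_le' (not_lt.1 hlt)
    exact hj (tor_vanish _ hs _ m)

end

section
variable (k : Type) [Field k]
open MvPowerSeries

lemma dvd_of (i j : Fin 2) (hij : i ≠ j) (f : MvPowerSeries (Fin 2) k)
    (h : (X j : MvPowerSeries (Fin 2) k) ∣ X i * f) : (X j : MvPowerSeries (Fin 2) k) ∣ f := by
  rw [X_dvd_iff] at h ⊢
  intro m hm
  have := h (Finsupp.single i 1 + m) (by simp [hm, hij])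
  rw [X, coeff_add_monomial_mul, one_mul] at this
  exact this

lemma mk_zero (f : MvPowerSeries (Fin 2) k) : (Ideal.Quotient.mk _ f : Rxy k) = 0 ↔
    ∃ g, f = X 0 * X 1 * g := by
  rw [Ideal.Quotient.eq_zero_iff_mem, Ideal.mem_span_singleton]
  rfl

lemma X_ne (i : Fin 2) : (X i : MvPowerSeries (Fin 2) k) ≠ 0 := by
  intro h
  have := congrArg (coeff (Finsupp.single i 1)) h
  rw [coeff_X] at this
  simp at this

end
end Pf

/-- for `R = k[[x,y]]/(xy)`, `M = k = R/(x,y)` and `N = R/(x+y)`,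
one has `pd N = 1`, `pd M = ∞`, `Ext^i(M,N) = 0` for all `i ≥ 2`; moreover `N`
is Tor-rigid but not a test module. -/
theorem stmt12 (k : Type) [Field k] :
    projDim (Rxy k)
      (ModuleCat.of (Rxy k) (Rxy k ⧸ Ideal.span {xcl k + ycl k})) = 1 ∧
    projDim (Rxy k)
      (ModuleCat.of (Rxy k) (Rxy k ⧸ Ideal.span {xcl k, ycl k})) = ⊤ ∧
    (∀ i : ℕ, 2 ≤ i → Subsingleton
      (ext (Rxy k) i (ModuleCat.of (Rxy k) (Rxy k ⧸ Ideal.span {xcl k, ycl k}))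
        (ModuleCat.of (Rxy k) (Rxy k ⧸ Ideal.span {xcl k + ycl k})))) ∧
    TorRigid (Rxy k) (ModuleCat.of (Rxy k) (Rxy k ⧸ Ideal.span {xcl k + ycl k})) ∧
    ¬ TestModule (Rxy k)
        (ModuleCat.of (Rxy k) (Rxy k ⧸ Ideal.span {xcl k + ycl k})) := by
  refine Pf.main (xcl k) (ycl k) ?_ ?_ ?_ ?_ ?_
  · rw [← map_mul, Pf.mk_zero]
    exact ⟨1, by ring⟩
  · intro a ha
    obtain ⟨a, rfl⟩ := Ideal.Quotient.mk_surjective a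
    rw [← map_mul, Pf.mk_zero] at ha
    obtain ⟨g, hg⟩ := ha
    refine ⟨Ideal.Quotient.mk _ g, ?_⟩
    rw [← map_mul, mul_left_cancel₀ (Pf.X_ne k 0) (hg.trans (mul_assoc _ _ _))]
  · intro a ha
    obtain ⟨a, rfl⟩ := Ideal.Quotient.mk_surjective a
    rw [← map_mul, Pf.mk_zero] at ha
    obtain ⟨g, hg⟩ := ha
    refine ⟨Ideal.Quotient.mk _ g, ?_⟩
    rw [← map_mul, mul_left_cancel₀ (Pf.X_ne k 1) (hg.trans (by ring : _ = _ * (_ * g)))]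
  · intro a b hab
    obtain ⟨a, rfl⟩ := Ideal.Quotient.mk_surjective a
    obtain ⟨b, rfl⟩ := Ideal.Quotient.mk_surjective b
    rw [← sub_eq_zero, ← map_mul, ← map_mul, ← map_sub, Pf.mk_zero] at hab
    obtain ⟨g, hg⟩ := hab
    obtain ⟨c, rfl⟩ := Pf.dvd_of k 0 1 (by decide) a
      ⟨b + MvPowerSeries.X 0 * g, by linear_combination hg⟩
    rw [← map_mul, Pf.mk_zero]
    exact ⟨c, by ring⟩
  · intro h
    rw [Ideal.mem_span_pair] at h
    obtain ⟨a, b, h⟩ := h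
    obtain ⟨a, rfl⟩ := Ideal.Quotient.mk_surjective a
    obtain ⟨b, rfl⟩ := Ideal.Quotient.mk_surjective b
    rw [← sub_eq_zero, ← map_mul, ← map_mul, ← map_add, ← map_one (Ideal.Quotient.mk _),
      ← map_sub, Pf.mk_zero] at h
    obtain ⟨g, hg⟩ := h
    have := congrArg MvPowerSeries.constantCoeff hg
    simp at this
end
end

section
/- Let R be a commutative Noetherian local ring admitting a dualizing complex, and let C be a semidualizing R-module with finite injective dimension. Then R is Cohen-Macaulay and C is a dualizing module. -/
open CategoryTheory

noncomputable section

variable (R : Type) [CommRing R]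

/-- a semidualizing module: `R → Hom_R(C,C)` is bijective and
`Ext^i_R(C,C) = 0` for all `i ≥ 1`. -/
def Semidualizing (C : ModuleCat R) : Prop :=
  Function.Bijective (fun r : R => (r • LinearMap.id : C →ₗ[R] C)) ∧
  ∀ i : ℕ, 1 ≤ i → Subsingleton (ext R i C C)

namespace BassAux

open Abelian Pointwise

/-- `Ext^i(X,N)` is killed by one element outside `Q`. -/
def Kill {R : Type} [CommRing R] (Q : Ideal R) (X N : ModuleCat.{0} R) (i : ℕ) : Prop :=
  ∃ y : R, y ∉ Q ∧ ∀ e : Abelian.Ext X N i, y • e = 0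

variable {R}

lemma nak {E : Type} [AddCommGroup E] [Module R E] [Module.Finite R E] (Q : Ideal R)
    [hQ : Q.IsPrime] (x y : R) (hx : x ∈ Q) (hy : y ∉ Q)
    (h : ∀ e : E, ∃ e' : E, y • e = x • e') : ∃ z, z ∉ Q ∧ ∀ e : E, z • e = 0 := by
  obtain ⟨p, hm, -, hc, h0⟩ :=
    LinearMap.exists_monic_and_natDegree_eq_and_coeff_mem_pow_and_aeval_eq_zero R
      (algebraMap R (Module.End R E) y) Q (by
        rintro _ ⟨e, rfl⟩
        obtain ⟨e', he⟩ := h e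
        rw [Module.algebraMap_end_apply, he]
        exact Submodule.smul_mem_smul hx trivial)
  refine ⟨p.eval y, ?_, ?_⟩
  · intro hmem
    have hp : p.map (Ideal.Quotient.mk Q) = Polynomial.X ^ p.natDegree := by
      ext k
      rw [Polynomial.coeff_map, Polynomial.coeff_X_pow]
      split_ifs with hk
      · rw [hk, hm.coeff_natDegree, map_one]
      · rw [Ideal.Quotient.eq_zero_iff_mem]
        rcases lt_or_gt_of_ne hk with h1 | h1
        · exact Ideal.pow_le_self (by omega) (hc k)
        · rw [Polynomial.coeff_eq_zero_of_natDegree_lt h1]; exact Q.zero_mem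
    have := Ideal.Quotient.eq_zero_iff_mem.mpr hmem
    rw [← Polynomial.eval₂_at_apply, ← Polynomial.eval_map, hp, Polynomial.eval_pow,
      Polynomial.eval_X, ← map_pow, Ideal.Quotient.eq_zero_iff_mem] at this
    exact hy (hQ.mem_of_pow_mem _ this)
  · intro e
    rw [Polynomial.aeval_algebraMap_apply, Polynomial.coe_aeval_eq_eval] at h0
    have := LinearMap.congr_fun h0 e
    simpa using this

lemma Kill.ses {Q : Ideal R} [hQ : Q.IsPrime] {S : ShortComplex (ModuleCat.{0} R)}
    (hS : S.ShortExact) {N : ModuleCat.{0} R} {i : ℕ} (h1 : Kill Q S.X₁ N i)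
    (h3 : Kill Q S.X₃ N i) : Kill Q S.X₂ N i := by
  obtain ⟨y1, hy1, h1⟩ := h1
  obtain ⟨y3, hy3, h3⟩ := h3
  refine ⟨y3 * y1, fun h => (hQ.mem_or_mem h).elim hy3 hy1, fun e => ?_⟩
  obtain ⟨e3, he3⟩ := Ext.contravariant_sequence_exact₂ hS N (y1 • e)
    (by rw [Ext.comp_smul, h1])
  rw [mul_smul, ← he3, ← Ext.comp_smul, h3, Ext.comp_zero]

lemma ann_smul {X N : ModuleCat.{0} R} {r : R} (hr : r ∈ Module.annihilator R X) {i : ℕ}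
    (e : Abelian.Ext X N i) : r • e = 0 := by
  have h0 : r • 𝟙 X = 0 := by
    simp [← ModuleCat.lsmul_eq_smul_id, Module.mem_annihilator_iff_lsmul_eq_zero.mp hr]
  have smul_eq : r • e = (Ext.mk₀ (r • 𝟙 X)).comp e (zero_add i) := by simp [Ext.mk₀_smul]
  rw [smul_eq, h0]; simp

lemma Kill.of_ann {Q : Ideal R} {X N : ModuleCat.{0} R} {i : ℕ} {r : R}
    (hr : r ∈ Module.annihilator R X) (h : r ∉ Q) : Kill Q X N i :=
  ⟨r, h, ann_smul hr⟩

lemma Kill.of_iso {Q : Ideal R} {X Y N : ModuleCat.{0} R} (f : X ≅ Y) {i : ℕ}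
    (h : Kill Q Y N i) : Kill Q X N i := by
  obtain ⟨y, hy, h⟩ := h
  refine ⟨y, hy, fun e => ?_⟩
  have : e = (Ext.mk₀ f.hom).comp ((Ext.mk₀ f.inv).comp e (zero_add i)) (zero_add i) := by
    rw [← Ext.comp_assoc (a₁₂ := 0) _ _ _ (zero_add 0) _ (by simp)]; simp
  rw [this, ← Ext.comp_smul, h, Ext.comp_zero]

lemma Kill.of_primes [IsNoetherianRing R] {Q : Ideal R} [hQ : Q.IsPrime] {N : ModuleCat.{0} R}
    {i : ℕ} (X : Type) [AddCommGroup X] [Module R X] (hX : Module.Finite R X)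
    (h : ∀ p : Ideal R, p.IsPrime → Module.annihilator R X ≤ p →
      Kill Q (ModuleCat.of R (R ⧸ p)) N i) : Kill Q (ModuleCat.of R X) N i := by
  revert h
  induction hX using IsNoetherianRing.induction_on_isQuotientEquivQuotientPrime R with
  | subsingleton X =>
    intro _
    refine Kill.of_ann (r := 1) (by rw [Module.mem_annihilator]; intro m; exact Subsingleton.elim _ _) ?_
    exact fun h => hQ.ne_top ((Ideal.eq_top_iff_one _).mpr h)
  | quotient X p f =>
    intro h
    refine Kill.of_iso f.toModuleIso (h p.1 p.2 ?_)
    rw [f.annihilator_eq, Ideal.annihilator_quotient]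
  | exact X1 X2 X3 f g hf hg hfg h1 h3 =>
    intro h
    have hS := ModuleCat.shortComplex_shortExact
      (ModuleCat.shortComplexOfCompEqZero f g hfg.linearMap_comp_eq_zero) hfg hf hg
    refine Kill.ses hS (h1 fun p hp hle => h p hp (le_trans ?_ hle))
      (h3 fun p hp hle => h p hp (le_trans ?_ hle))
    · exact LinearMap.annihilator_le_of_injective f hf
    · exact LinearMap.annihilator_le_of_surjective g hg

lemma con1 {S : ShortComplex (ModuleCat.{0} R)} (hS : S.ShortExact) {N : ModuleCat.{0} R} {i : ℕ}
    {y : R} (h : ∀ e : Abelian.Ext S.X₃ N (i + 1), y • e = 0) (e : Abelian.Ext S.X₁ N i) :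
    ∃ e' : Abelian.Ext S.X₂ N i, (Ext.mk₀ S.f).comp e' (zero_add i) = y • e :=
  Ext.contravariant_sequence_exact₁ hS N (y • e) (add_comm 1 i)
    (by rw [Ext.comp_smul]; exact h _)

lemma con3 {S : ShortComplex (ModuleCat.{0} R)} (hS : S.ShortExact) {N : ModuleCat.{0} R} {i : ℕ}
    (h1 : Subsingleton (Abelian.Ext S.X₂ N (i + 1))) (h2 : Subsingleton (Abelian.Ext S.X₁ N i)) :
    Subsingleton (Abelian.Ext S.X₃ N (i + 1)) := by
  refine subsingleton_of_forall_eq 0 fun e => ?_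
  obtain ⟨e1, he1⟩ := Ext.contravariant_sequence_exact₃ hS N e (h1.elim _ _) (add_comm 1 i)
  rw [← he1, h2.elim e1 0, Ext.comp_zero]

lemma cov3 {S : ShortComplex (ModuleCat.{0} R)} (hS : S.ShortExact) {A : ModuleCat.{0} R} {i : ℕ}
    (h1 : Subsingleton (Abelian.Ext A S.X₁ (i + 1))) (h2 : Subsingleton (Abelian.Ext A S.X₂ i)) :
    Subsingleton (Abelian.Ext A S.X₃ i) := by
  refine subsingleton_of_forall_eq 0 fun e => ?_
  obtain ⟨e1, he1⟩ := Ext.covariant_sequence_exact₃ A hS e rfl (h1.elim _ _)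
  rw [← he1, h2.elim e1 0, Ext.zero_comp]

lemma cov1 {S : ShortComplex (ModuleCat.{0} R)} (hS : S.ShortExact) {A : ModuleCat.{0} R} {t : ℕ}
    (h1 : Subsingleton (Abelian.Ext A S.X₃ t))
    (h2 : ∀ e : Abelian.Ext A S.X₁ (t + 1), e.comp (Ext.mk₀ S.f) (add_zero _) = 0) :
    Subsingleton (Abelian.Ext A S.X₁ (t + 1)) := by
  refine subsingleton_of_forall_eq 0 fun e => ?_
  obtain ⟨e3, he3⟩ := Ext.covariant_sequence_exact₁ A hS (n₀ := t) e (h2 e) rfl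
  rw [← he3, h1.elim e3 0, Ext.zero_comp]

lemma smul_comp_l (M N : ModuleCat.{0} R) (x : R) (i : ℕ) (e : Abelian.Ext M N i) :
    (Ext.mk₀ (x • 𝟙 M)).comp e (zero_add i) = x • e := by
  rw [Ext.mk₀_smul, Ext.smul_comp, Ext.mk₀_id_comp]

/-- The key Nakayama step. -/
lemma Kill.step [IsNoetherianRing R] {Q : Ideal R} [hQ : Q.IsPrime] {N : ModuleCat.{0} R}
    [Module.Finite R N] {i : ℕ} {P : Ideal R} [hP : P.IsPrime] {x : R} (hxP : x ∉ P) (hxQ : x ∈ Q)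
    (h : ∀ p : Ideal R, p.IsPrime → P < p → Kill Q (ModuleCat.of R (R ⧸ p)) N (i + 1)) :
    Kill Q (ModuleCat.of R (R ⧸ P)) N i := by
  have reg : IsSMulRegular (ModuleCat.of R (R ⧸ P)) x := by
    intro a b hab
    change x • (a : R ⧸ P) = x • (b : R ⧸ P) at hab
    rw [Algebra.smul_def, Algebra.smul_def] at hab
    refine mul_left_cancel₀ ?_ hab
    rw [Ideal.Quotient.algebraMap_eq, Ne, Ideal.Quotient.eq_zero_iff_mem]
    exact hxP
  have hS := reg.smulShortComplex_shortExact
  have h3 : Kill Q (ModuleCat.of R (QuotSMulTop x (R ⧸ P))) N (i + 1) := by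
    refine Kill.of_primes _ inferInstance fun p hp hle => h p hp ?_
    refine lt_of_le_of_ne ?_ ?_
    · refine le_trans ?_ hle
      refine le_trans ?_ (LinearMap.annihilator_le_of_surjective
        (Submodule.mkQ (x • (⊤ : Submodule R (R ⧸ P)))) (Submodule.mkQ_surjective _))
      rw [Ideal.annihilator_quotient]
    · rintro rfl
      apply hxP
      apply hle
      rw [Module.mem_annihilator]
      intro m
      obtain ⟨m, rfl⟩ := Submodule.mkQ_surjective _ m
      rw [← map_smul, Submodule.mkQ_apply, Submodule.Quotient.mk_eq_zero]
      exact Submodule.smul_mem_pointwise_smul _ _ _ trivial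
  obtain ⟨y, hy, h3⟩ := h3
  refine nak Q x y hxQ hy fun e => ?_
  obtain ⟨e', he'⟩ := con1 hS h3 e
  rw [ModuleCat.smulShortComplex_f_eq_smul_id] at he'
  exact ⟨e', he'.symm.trans (smul_comp_l _ _ _ _ e')⟩

lemma not_kill_of_height [IsNoetherianRing R] {N : ModuleCat.{0} R} [Module.Finite R N]
    (hN : Module.annihilator R N = ⊥) (n : ℕ) (Q : PrimeSpectrum R) (hQ : Order.height Q = n) :
    ¬ Kill Q.asIdeal (ModuleCat.of R (R ⧸ Q.asIdeal)) N n := by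
  induction n generalizing Q with
  | zero =>
    rintro ⟨y, hy, h⟩
    have hmin : IsMin Q := by simpa using hQ
    have hmem : Q.asIdeal ∈ (Module.annihilator R N).minimalPrimes := by
      rw [hN]
      exact PrimeSpectrum.isMin_iff.mp hmin
    have hass := Module.associatedPrimes.minimalPrimes_annihilator_subset_associatedPrimes R N hmem
    rw [AssociatedPrimes.mem_iff, isAssociatedPrime_iff_exists_injective_linearMap] at hass
    obtain ⟨-, f, hf⟩ := hass
    have := h (Ext.mk₀ (ModuleCat.ofHom f))
    rw [← Ext.mk₀_smul, Ext.mk₀_eq_zero_iff] at this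
    have h1 : y • f 1 = 0 :=
      congrArg (fun g => g.hom (1 : R ⧸ Q.asIdeal)) this
    rw [← map_smul] at h1
    have h2 := hf (h1.trans (map_zero f).symm)
    rw [Algebra.smul_def, mul_one, Ideal.Quotient.algebraMap_eq,
      Ideal.Quotient.eq_zero_iff_mem] at h2
    exact hy h2
  | succ n ih =>
    intro hk
    obtain ⟨hlt, ⟨P, hPQ, hP⟩, hall⟩ := Order.height_eq_coe_add_one_iff.mp
      (by exact_mod_cast hQ : Order.height Q = (n : ℕ∞) + 1)
    apply ih P hP
    obtain ⟨x, hxQ, hxP⟩ := SetLike.exists_of_lt (show P.asIdeal < Q.asIdeal from hPQ)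
    have : Kill Q.asIdeal (ModuleCat.of R (R ⧸ P.asIdeal)) N n := by
      refine Kill.step hxP hxQ fun p hp hPp => ?_
      by_cases hpQ : p ≤ Q.asIdeal
      · rcases hpQ.eq_or_lt with rfl | hlt'
        · exact hk
        · exfalso
          have h1 := hall ⟨p, hp⟩ hlt'
          have h2 : Order.height P < Order.height (⟨p, hp⟩ : PrimeSpectrum R) :=
            Order.height_strictMono hPp (by rw [hP]; exact ENat.natCast_lt_top n)
          rw [hP] at h2
          exact absurd h2 (not_lt.mpr h1)
      · obtain ⟨y, hyp, hyQ⟩ := SetLike.not_le_iff_exists.mp hpQ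
        refine Kill.of_ann (r := y) ?_ hyQ
        change y ∈ Module.annihilator R (R ⧸ p)
        rwa [Ideal.annihilator_quotient]
    obtain ⟨y, hy, h⟩ := this
    exact ⟨y, fun hyP => hy (hPQ.le hyP), h⟩

section Loc
variable [IsLocalRing R]

lemma Kill.subsingleton {X N : ModuleCat.{0} R} {i : ℕ}
    (h : Kill (IsLocalRing.maximalIdeal R) X N i) : Subsingleton (Abelian.Ext X N i) := by
  obtain ⟨y, hy, h⟩ := h
  have hu : IsUnit y := by simpa using hy
  refine subsingleton_of_forall_eq 0 fun e => ?_
  exact (hu.smul_eq_zero).mp (h e)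

lemma kill_of_subsingleton {X N : ModuleCat.{0} R} {i : ℕ}
    (h : Subsingleton (Abelian.Ext X N i)) : Kill (IsLocalRing.maximalIdeal R) X N i :=
  ⟨1, by simp, fun e => Subsingleton.elim _ _⟩

lemma vanish [IsNoetherianRing R] {N : ModuleCat.{0} R} [Module.Finite R N] (r : ℕ)
    (h : ∀ j, r < j → Subsingleton
      (Abelian.Ext (ModuleCat.of R (R ⧸ IsLocalRing.maximalIdeal R)) N j))
    (X : Type) [AddCommGroup X] [Module R X] (hX : Module.Finite R X) (j : ℕ) (hj : r < j) :
    Subsingleton (Abelian.Ext (ModuleCat.of R X) N j) := by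
  refine Kill.subsingleton (Kill.of_primes X hX fun p hp hle => ?_)
  clear hle hX
  induction p using IsNoetherian.induction generalizing j with
  | hgt P ih =>
  by_cases hPm : P = IsLocalRing.maximalIdeal R
  · subst hPm; exact kill_of_subsingleton (h j hj)
  · have hlt : P < IsLocalRing.maximalIdeal R :=
      lt_of_le_of_ne (IsLocalRing.le_maximalIdeal hp.ne_top) hPm
    obtain ⟨x, hxQ, hxP⟩ := SetLike.exists_of_lt hlt
    exact Kill.step hxP hxQ fun p hp' hPp => ih p hPp (j + 1) (by omega) hp'

local notation "kk" => ModuleCat.of R (R ⧸ IsLocalRing.maximalIdeal R)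

lemma bound [IsNoetherianRing R] {N : ModuleCat.{0} R} [Module.Finite R N] (r : ℕ)
    (h : ∀ j, r < j → Subsingleton (Abelian.Ext kk N j))
    (hr : ¬ Subsingleton (Abelian.Ext kk N r)) (t : ℕ) (Y : Type) [AddCommGroup Y] [Module R Y]
    (hY : Module.Finite R Y) (s : ℕ)
    (hs : ∀ i, s < i → Subsingleton (Abelian.Ext (ModuleCat.of R Y) N i))
    (ht : ∀ i, i < t → Subsingleton (Abelian.Ext kk (ModuleCat.of R Y) i))
    (ht' : ¬ Subsingleton (Abelian.Ext kk (ModuleCat.of R Y) t)) : r ≤ s + t := by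
  induction t generalizing Y s with
  | zero =>
    by_contra hlt
    push Not at hlt
    apply hr
    have : ∃ f : (R ⧸ IsLocalRing.maximalIdeal R) →ₗ[R] Y, f ≠ 0 := by
      by_contra hcon
      push Not at hcon
      apply ht'
      have : Subsingleton ((R ⧸ IsLocalRing.maximalIdeal R) →ₗ[R] Y) :=
        subsingleton_of_forall_eq 0 hcon
      exact (Ext.addEquiv₀.trans ModuleCat.homAddEquiv).subsingleton
    obtain ⟨f, hf⟩ := this
    have hsimp : IsSimpleModule R (R ⧸ IsLocalRing.maximalIdeal R) :=
      isSimpleModule_iff_quot_maximal.mpr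
        ⟨IsLocalRing.maximalIdeal R, inferInstance, ⟨LinearEquiv.refl R _⟩⟩
    have hinj : Function.Injective f := (LinearMap.injective_or_eq_zero f).resolve_right hf
    have hS := ModuleCat.shortComplex_shortExact
      (ModuleCat.shortComplexOfCompEqZero f (LinearMap.range f).mkQ
        f.exact_map_mkQ_range.linearMap_comp_eq_zero)
      f.exact_map_mkQ_range hinj (Submodule.mkQ_surjective _)
    refine subsingleton_of_forall_eq 0 fun e => ?_
    have hv := vanish r h (Y ⧸ LinearMap.range f) inferInstance (r + 1) (by omega)
    obtain ⟨e2, rfl⟩ := Ext.contravariant_sequence_exact₁ hS N e (add_comm 1 r) (hv.elim _ _)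
    have hs' := hs r (by omega)
    rw [hs'.elim e2 0, Ext.comp_zero]
  | succ t ih =>
    have h0 : Subsingleton ((R ⧸ IsLocalRing.maximalIdeal R) →ₗ[R] Y) := by
      have := ht 0 (by omega)
      exact ((Ext.addEquiv₀ (X := kk) (Y := ModuleCat.of R Y)).trans
        ModuleCat.homAddEquiv).symm.subsingleton
    obtain ⟨x, hxm, hreg⟩ := IsSMulRegular.subsingleton_linearMap_iff.mp h0
    have hS := IsSMulRegular.smulShortComplex_shortExact (M := ModuleCat.of R Y) hreg
    have := ih (QuotSMulTop x Y) inferInstance (s + 1) ?_ ?_ ?_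
    · omega
    · intro i hi
      obtain ⟨i, rfl⟩ : ∃ i', i = i' + 1 := ⟨i - 1, by omega⟩
      exact con3 hS (hs (i + 1) (by omega)) (hs i (by omega))
    · intro i hi
      exact cov3 hS (ht (i + 1) (by omega)) (ht i (by omega))
    · intro hsub
      apply ht'
      refine cov1 hS hsub fun e => ?_
      rw [ModuleCat.smulShortComplex_f_eq_smul_id]
      exact (Ext.smul_eq_comp_mk₀ (R := R) (Y := ModuleCat.of R Y) e x).symm.trans (ann_smul hxm e)

lemma main [IsNoetherianRing R] {N : ModuleCat.{0} R} [Module.Finite R N]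
    (hN : Module.annihilator R N = ⊥) (b : ℕ)
    (hb : ∀ i, b < i → Subsingleton (Abelian.Ext kk N i)) :
    ∃ d : ℕ, ringKrullDim R = d ∧ ¬ Subsingleton (Abelian.Ext kk (ModuleCat.of R R) d) ∧
      ∀ i, i < d → Subsingleton (Abelian.Ext kk (ModuleCat.of R R) i) := by
  classical
  have hfin : (IsLocalRing.maximalIdeal R).height ≠ ⊤ :=
    ((IsLocalRing.maximalIdeal R).finiteHeight_iff.mp inferInstance).resolve_left
      Ideal.IsPrime.ne_top'
  obtain ⟨d, hd⟩ := ENat.ne_top_iff_exists.mp hfin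
  have hdim : ringKrullDim R = d := by
    rw [← IsLocalRing.maximalIdeal_height_eq_ringKrullDim, ← hd]; rfl
  have hh : Order.height (IsLocalRing.closedPoint R) = d := by
    rw [hd]; exact (PrimeSpectrum.height_eq_orderHeight (IsLocalRing.closedPoint R)).symm
  have hR : ¬ Subsingleton (Abelian.Ext kk (ModuleCat.of R R) d) := fun hs =>
    not_kill_of_height (N := ModuleCat.of R R) (by
      change Module.annihilator R R = ⊥
      exact Module.annihilator_eq_bot.mpr inferInstance) d
      (IsLocalRing.closedPoint R) hh (kill_of_subsingleton hs)
  have hNd : ¬ Subsingleton (Abelian.Ext kk N d) := fun hs =>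
    not_kill_of_height (N := N) hN d
      (IsLocalRing.closedPoint R) hh (kill_of_subsingleton hs)
  refine ⟨d, hdim, hR, ?_⟩
  have hdb : d ≤ b := by
    by_contra hlt
    exact hNd (hb d (by omega))
  let r := Nat.findGreatest (fun i => ¬ Subsingleton (Abelian.Ext kk N i)) b
  have hr : ¬ Subsingleton (Abelian.Ext kk N r) :=
    Nat.findGreatest_spec (P := fun i => ¬ Subsingleton (Abelian.Ext kk N i)) hdb hNd
  have hdr : d ≤ r := Nat.le_findGreatest hdb hNd
  have hvan : ∀ j, r < j → Subsingleton (Abelian.Ext kk N j) := by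
    intro j hj
    by_cases hjb : j ≤ b
    · exact not_not.mp (Nat.findGreatest_is_greatest hj hjb)
    · exact hb j (by omega)
  have hex : ∃ t, ¬ Subsingleton (Abelian.Ext kk (ModuleCat.of R R) t) := ⟨d, hR⟩
  have := bound r hvan hr (Nat.find hex) R inferInstance 0
    (fun i hi => by
      obtain ⟨i, rfl⟩ : ∃ i', i = i' + 1 := ⟨i - 1, by omega⟩
      refine subsingleton_of_forall_eq 0 fun e => Ext.eq_zero_of_projective e)
    (fun i hi => not_not.mp (Nat.find_min hex hi)) (Nat.find_spec hex)
  intro i hi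
  exact not_not.mp (Nat.find_min hex (by omega))

end Loc

end BassAux
namespace BassAux
open Abelian

lemma homology_sub {R : Type} [CommRing R] (K : CochainComplex (ModuleCat.{0} R) ℕ) (n : ℕ) :
    Subsingleton (K.homology n) ↔ K.ExactAt n := by
  rw [HomologicalComplex.exactAt_iff_isZero_homology, ModuleCat.isZero_iff_subsingleton]

lemma z1 {R : Type} [CommRing R] {M N : ModuleCat.{0} R} (P : ProjectiveResolution M)
    (f : ((ChainComplex.single₀ (ModuleCat.{0} R)).obj M).X 0 ⟶ N) :
    P.complex.d 1 0 ≫ P.π.f 0 ≫ f = 0 := by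
  rw [← Category.assoc, P.complex_d_comp_π_f_zero, Limits.zero_comp]

lemma z2 {R : Type} [CommRing R] {M N : ModuleCat.{0} R} (P : ProjectiveResolution M)
    (f : ((ChainComplex.single₀ (ModuleCat.{0} R)).obj M).X 0 ⟶ N) (g : P.complex.X 0 ⟶ N)
    (h : P.complex.d 0 0 ≫ g = P.π.f 0 ≫ f) : f = 0 := by
  rw [P.complex.shape 0 0 (by simp), Limits.zero_comp] at h
  rw [← cancel_epi (P.π.f 0), ← h, Limits.comp_zero]

lemma z3 {R : Type} [CommRing R] {M N : ModuleCat.{0} R} (P : ProjectiveResolution M)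
    (f : P.complex.X 0 ⟶ N) (hf : P.complex.d 1 0 ≫ f = 0)
    (h : ∀ g : ((ChainComplex.single₀ (ModuleCat.{0} R)).obj M).X 0 ⟶ N, g = 0) : f = 0 := by
  have h2 : P.π.f 0 ≫ P.isColimitCokernelCofork.desc (Limits.CokernelCofork.ofπ f hf) = f :=
    P.isColimitCokernelCofork.fac (Limits.CokernelCofork.ofπ f hf) .one
  rw [← h2]
  exact (congrArg (fun g => P.π.f 0 ≫ g) (h _)).trans Limits.comp_zero

lemma bridge {R : Type} [CommRing R] (n : ℕ) (M N : ModuleCat.{0} R) :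
    Subsingleton (ext R n M N) ↔ Subsingleton (Abelian.Ext M N n) := by
  let P := ProjectiveResolution.of M
  have h1 : Subsingleton (ext R n M N) ↔ (P.complex.linearYonedaObj R N).ExactAt n := by
    rw [← homology_sub]
    exact (P.isoExt (R := R) n N).toLinearEquiv.toEquiv.subsingleton_congr
  rw [h1]
  cases n with
  | zero =>
    rw [HomologicalComplex.exactAt_iff' _ 0 0 1 (by simp) (by simp),
      ShortComplex.moduleCat_exact_iff]
    rw [Ext.addEquiv₀.toEquiv.subsingleton_congr]
    constructor
    · intro h
      refine subsingleton_of_forall_eq 0 fun f => ?_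
      obtain ⟨g, hg⟩ := h (P.π.f 0 ≫ f) (z1 P f)
      exact z2 P f g hg
    · intro h f hf
      refine ⟨0, ?_⟩
      rw [map_zero]
      exact (z3 P f hf fun g => h.elim _ _).symm
  | succ n =>
    rw [HomologicalComplex.exactAt_iff' _ n (n+1) (n+2) (by simp) (by simp),
      ShortComplex.moduleCat_exact_iff]
    constructor
    · intro h
      refine subsingleton_of_forall_eq 0 fun e => ?_
      obtain ⟨f, hf, rfl⟩ := P.extMk_surjective e (n + 2) rfl
      rw [P.extMk_eq_zero_iff _ _ _ _ n rfl]
      exact h f hf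
    · intro h f hf
      exact (P.extMk_eq_zero_iff f (n + 2) rfl hf n rfl).mp (h.elim _ _)

end BassAux

/-- over a Noetherian local ring with a dualizing complex (a
homomorphic image of a Gorenstein local ring), a semidualizing module of finite
injective dimension forces `R` Cohen-Macaulay, and `C` is a dualizing module. -/
theorem stmt13 [IsNoetherianRing R] [IsLocalRing R]
    (hdc : ∃ (Q : Type) (_ : CommRing Q) (_ : IsNoetherianRing Q) (_ : IsLocalRing Q)
      (f : Q →+* R), Function.Surjective f ∧ injDim Q (ModuleCat.of Q Q) < ⊤)
    (C : ModuleCat R) [Module.Finite R C]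
    (hC : Semidualizing R C) (hid : injDim R C < ⊤) :
    (depth R (ModuleCat.of R R) : WithBot ℕ∞) = ringKrullDim R ∧
    Semidualizing R C ∧ injDim R C < ⊤ := by
  refine ⟨?_, hC, hid⟩
  obtain ⟨n, hn, hlt⟩ := sInf_lt_iff.mp hid
  obtain ⟨b, rfl⟩ := ENat.ne_top_iff_exists.mp hlt.ne
  have hann : Module.annihilator R C = ⊥ := by
    rw [eq_bot_iff]
    intro r hr
    rw [Module.mem_annihilator] at hr
    have : r = 0 := hC.1.1 (by
      refine LinearMap.ext fun c => ?_
      simp [hr c])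
    simpa using this
  obtain ⟨d, hd, hne, hlt⟩ := BassAux.main hann b fun i hi =>
    (BassAux.bridge i _ C).mp (hn i _ (by exact_mod_cast hi))
  rw [hd]
  have : depth R (ModuleCat.of R R) = d := by
    refine le_antisymm (sInf_le ⟨d, rfl, fun h => hne ((BassAux.bridge d _ _).mp h)⟩)
      (le_sInf ?_)
    rintro _ ⟨i, rfl, hi⟩
    by_contra hcon
    exact hi ((BassAux.bridge i _ _).mpr (hlt i (by simpa using hcon)))
  rw [this]; rfl
end
end

section
/- Let R be a commutative Noetherian local ring and C a semidualizing R-module. If pd_R(C) < ∞, then C ≅ R. -/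
open CategoryTheory

noncomputable section

variable (R : Type) [CommRing R]

open CategoryTheory

lemma aux_bridge (n : ℕ) (M X : ModuleCat R) (h : Subsingleton (ext R (n + 1) M X)) :
    Subsingleton (Abelian.Ext M X (n + 1)) := by
  let P := projectiveResolution M
  have hz : Limits.IsZero ((P.complex.linearYonedaObj R X).homology (n + 1)) :=
    Limits.IsZero.of_iso (ModuleCat.isZero_of_subsingleton _)
      (P.isoExt (R := R) (n + 1) X).symm
  rw [← HomologicalComplex.exactAt_iff_isZero_homology,
    HomologicalComplex.exactAt_iff' _ n (n + 1) (n + 2) (by simp) (by simp),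
    ShortComplex.moduleCat_exact_iff] at hz
  refine ⟨fun a b => ?_⟩
  suffices H : ∀ a : Abelian.Ext M X (n + 1), a = 0 by rw [H a, H b]
  intro a
  obtain ⟨f, hf, rfl⟩ := P.extMk_surjective a (n + 2) rfl
  rw [P.extMk_eq_zero_iff f (n + 2) rfl hf n rfl]
  obtain ⟨g, hg⟩ := hz f hf
  exact ⟨g, hg⟩

lemma aux_cover [IsLocalRing R] (M : Type) [AddCommGroup M] [Module R M] [Module.Finite R M] :
    ∃ (ι : Type) (_ : Finite ι) (f : (ι →₀ R) →ₗ[R] M), Function.Surjective f ∧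
      ∀ x, f x = 0 → ∀ i, x i ∈ IsLocalRing.maximalIdeal R := by
  let k := IsLocalRing.ResidueField R
  let w := Module.Free.chooseBasis k (TensorProduct R k M)
  obtain ⟨v, eq⟩ := (TensorProduct.mk_surjective R M k Ideal.Quotient.mk_surjective).comp_left w
  refine ⟨_, Module.Finite.finite_basis w, Finsupp.linearCombination R v, ?_, ?_⟩
  · rw [← LinearMap.range_eq_top, Finsupp.range_linearCombination]
    exact IsLocalRing.span_eq_top_of_tmul_eq_basis v w (congr_fun eq)
  · intro x hx i
    have h1 : Finsupp.linearCombination k w (x.mapRange (algebraMap R k) (map_zero _)) = 0 := by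
      have := congrArg (TensorProduct.mk R k M 1) hx
      rw [map_zero] at this
      rw [← this, Finsupp.linearCombination_apply, Finsupp.linearCombination_apply,
        Finsupp.sum_mapRange_index (by simp), Finsupp.sum, Finsupp.sum, map_sum]
      refine Finset.sum_congr rfl fun j _ => ?_
      rw [← eq]
      simp
    have h2 := linearIndependent_iff.mp w.linearIndependent _ h1
    have h3 := DFunLike.congr_fun h2 i
    simp only [Finsupp.mapRange_apply, Finsupp.coe_zero, Pi.zero_apply] at h3
    exact (IsLocalRing.residue_eq_zero_iff _).mp h3

lemma aux_drop [IsNoetherianRing R] [IsLocalRing R] (N : ModuleCat R) [Module.Finite R N]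
    [Nontrivial N] (n : ℕ) (M : ModuleCat R) [Module.Finite R M]
    (h : HasProjectiveDimensionLT M (n + 2)) (e : Subsingleton (Abelian.Ext M N (n + 1))) :
    HasProjectiveDimensionLT M (n + 1) := by
  induction n generalizing M with
  | zero =>
    obtain ⟨ι, _, f, hf, hm⟩ := aux_cover R M
    let S : ShortComplex (ModuleCat R) := f.shortComplexKer
    have hS : S.ShortExact := LinearMap.shortExact_shortComplexKer hf
    have hP : Projective S.X₂ := (IsProjective.iff_projective (R := R) (ι →₀ R)).mp inferInstance
    have h1 := (hS.hasProjectiveDimensionLT_X₃_iff 0 hP).mp h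
    have hK : Module.Projective R (LinearMap.ker f) :=
      (IsProjective.iff_projective (R := R) (LinearMap.ker f)).mpr
        (projective_iff_hasProjectiveDimensionLT_one.mpr h1)
    have hKf : Module.Free R (LinearMap.ker f) := by
      have : Module.Flat R (LinearMap.ker f) := inferInstance
      exact Module.free_of_flat_of_isLocalRing (R := R) (P := LinearMap.ker f)
    -- every map from the kernel extends
    have hext : ∀ g : LinearMap.ker f →ₗ[R] N, ∃ g' : (ι →₀ R) →ₗ[R] N,
        g' ∘ₗ (LinearMap.ker f).subtype = g := by
      intro g
      obtain ⟨x, hx⟩ := Abelian.Ext.contravariant_sequence_exact₁ hS N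
        (Abelian.Ext.mk₀ (ModuleCat.ofHom g : S.X₁ ⟶ N)) (n₁ := 1) rfl (e.elim _ _)
      obtain ⟨g', rfl⟩ := (Abelian.Ext.mk₀_bijective _ _).2 x
      rw [Abelian.Ext.mk₀_comp_mk₀, (Abelian.Ext.mk₀_bijective _ _).1.eq_iff] at hx
      exact ⟨g'.hom, congrArg ModuleCat.Hom.hom hx⟩
    have hsub : Subsingleton (LinearMap.ker f) := by
      by_contra hns
      rw [not_subsingleton_iff_nontrivial] at hns
      let b := Module.Free.chooseBasis R (LinearMap.ker f)
      obtain ⟨j⟩ := b.index_nonempty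
      have htop : (⊤ : Submodule R N) ≤ IsLocalRing.maximalIdeal R • ⊤ := by
        intro y _
        obtain ⟨g', hg'⟩ := hext (LinearMap.toSpanSingleton R N y ∘ₗ b.coord j)
        have hy : g' (b j : ι →₀ R) = y := by
          have := LinearMap.congr_fun hg' (b j)
          simpa using this
        rw [← hy, ← Finsupp.sum_single (b j : ι →₀ R), Finsupp.sum, map_sum]
        refine Submodule.sum_mem _ fun i _ => ?_
        rw [← mul_one ((b j : ι →₀ R) i), ← smul_eq_mul, ← Finsupp.smul_single, map_smul]
        exact Submodule.smul_mem_smul (hm _ (b j).2 i) trivial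
      have hbot := Submodule.eq_bot_of_le_smul_of_le_jacobson_bot
        (IsLocalRing.maximalIdeal R) (⊤ : Submodule R N) Module.Finite.fg_top htop
        (IsLocalRing.maximalIdeal_le_jacobson _)
      exact top_ne_bot hbot
    have hinj : Function.Injective f := by
      rw [← LinearMap.ker_eq_bot, ← Submodule.subsingleton_iff_eq_bot]
      exact hsub
    have : Module.Projective R M := Module.Projective.of_equiv (LinearEquiv.ofBijective f ⟨hinj, hf⟩)
    exact projective_iff_hasProjectiveDimensionLT_one.mp
      ((IsProjective.iff_projective (R := R) M).mp this)
  | succ n ih =>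
    obtain ⟨ι, _, f, hf, hm⟩ := aux_cover R M
    let S : ShortComplex (ModuleCat R) := f.shortComplexKer
    have hS : S.ShortExact := LinearMap.shortExact_shortComplexKer hf
    have hP : Projective S.X₂ := (IsProjective.iff_projective (R := R) (ι →₀ R)).mp inferInstance
    have h1 := (hS.hasProjectiveDimensionLT_X₃_iff (n + 1) hP).mp h
    refine (hS.hasProjectiveDimensionLT_X₃_iff n hP).mpr ?_
    have : Module.Finite R S.X₁ := inferInstanceAs (Module.Finite R (LinearMap.ker f))
    refine ih S.X₁ h1 ⟨fun a b => ?_⟩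
    suffices H : ∀ a : Abelian.Ext S.X₁ N (n + 1), a = 0 by rw [H a, H b]
    intro a
    obtain ⟨x, rfl⟩ := Abelian.Ext.contravariant_sequence_exact₁ hS N a
      (n₁ := n + 1 + 1) (add_comm _ _) (e.elim _ _)
    rw [Abelian.Ext.eq_zero_of_projective x, Abelian.Ext.comp_zero]

lemma aux_all [IsNoetherianRing R] [IsLocalRing R] (C : ModuleCat R) [Module.Finite R C]
    [Nontrivial C] (hExt : ∀ i : ℕ, 1 ≤ i → Subsingleton (ext R i C C)) (m : ℕ)
    (h : HasProjectiveDimensionLT C (m + 1)) : HasProjectiveDimensionLT C 1 := by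
  induction m with
  | zero => exact h
  | succ m ih => exact ih (aux_drop R C m C h (aux_bridge R m C C (hExt _ (by omega))))

/-- a semidualizing module of finite projective dimension is
isomorphic to `R`. -/
theorem stmt14 [IsNoetherianRing R] [IsLocalRing R]
    (C : ModuleCat R) [Module.Finite R C]
    (hC : Semidualizing R C) (hpd : projDim R C < ⊤) :
    Nonempty (C ≃ₗ[R] R) := by
  classical
  obtain ⟨hbij, hExt⟩ := hC
  have hnt : Nontrivial C := by
    by_contra hn
    rw [not_nontrivial_iff_subsingleton] at hn
    exact one_ne_zero (hbij.1 (LinearMap.ext fun x => Subsingleton.elim _ _) : (1 : R) = 0)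
  obtain ⟨a, ha, hat⟩ := sInf_lt_iff.mp hpd
  obtain ⟨m, rfl⟩ := ENat.ne_top_iff_exists.mp hat.ne
  have h0 : HasProjectiveDimensionLT C (m + 1) := by
    rw [hasProjectiveDimensionLT_iff]
    intro i hi Y e
    obtain ⟨j, rfl⟩ : ∃ j, i = j + 1 := ⟨i - 1, by omega⟩
    have := aux_bridge R j C Y (ha (j + 1) Y (by exact_mod_cast hi))
    exact Subsingleton.elim _ _
  have h1 := aux_all R C hExt m h0
  have hproj : Module.Projective R C :=
    (IsProjective.iff_projective (R := R) C).mpr (projective_iff_hasProjectiveDimensionLT_one.mpr h1)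
  have hfree : Module.Free R C := by
      have : Module.Flat R C := inferInstance
      exact Module.free_of_flat_of_isLocalRing (R := R)
  let e : R ≃ₗ[R] (C →ₗ[R] C) := LinearEquiv.ofBijective
    (LinearMap.toSpanSingleton R (C →ₗ[R] C) LinearMap.id) hbij
  have hr := e.finrank_eq
  rw [Module.finrank_self, Module.finrank_linearMap] at hr
  have hr1 : Module.finrank R C = Module.finrank R R := by
    rw [Module.finrank_self]
    exact Nat.eq_one_of_mul_eq_one_right hr.symm
  exact ⟨LinearEquiv.ofFinrankEq _ _ hr1⟩
end
end

section
/- Let (R, m) be a commutative Noetherian local ring, M a nonzero finitely generated test module, and N a nonzero finitely generated Cohen-Macaulay R-module. If Ext^i_R(M,N) = 0 for all sufficiently large i, then id_R(N) < ∞. -/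
open CategoryTheory

noncomputable section

variable (R : Type) [CommRing R]

section helpers

open CategoryTheory Abelian

variable {R}

lemma ext_sub_iff (i : ℕ) (M N : ModuleCat.{0} R) :
    Subsingleton (ext R (i+1) M N) ↔ Subsingleton (Abelian.Ext M N (i+1)) := by
  let P := ProjectiveResolution.of M
  have e := P.isoExt (R := R) (i+1) N
  rw [e.toLinearEquiv.toEquiv.subsingleton_congr, ← ModuleCat.isZero_iff_subsingleton,
    ← HomologicalComplex.exactAt_iff_isZero_homology]
  rw [HomologicalComplex.exactAt_iff' _ i (i+1) (i+2) (by simp) (by simp)]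
  rw [ShortComplex.moduleCat_exact_iff]
  constructor
  · intro h
    refine subsingleton_of_forall_eq 0 fun α => ?_
    obtain ⟨f, hf, rfl⟩ := P.extMk_surjective α (i+2) rfl
    rw [P.extMk_eq_zero_iff f _ rfl hf i rfl]
    obtain ⟨g, hg⟩ := h f hf
    exact ⟨g, hg⟩
  · intro h f hf
    obtain ⟨g, hg⟩ := (P.extMk_eq_zero_iff f (i+2) rfl hf i rfl).1 (Subsingleton.elim _ _)
    exact ⟨g, hg⟩

lemma ext_zero_sub (M N : ModuleCat.{0} R) (h : Subsingleton (ext R 0 M N)) (f : M ⟶ N) :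
    f = 0 := by
  let P := ProjectiveResolution.of M
  have e := P.isoExt (R := R) 0 N
  rw [e.toLinearEquiv.toEquiv.subsingleton_congr, ← ModuleCat.isZero_iff_subsingleton,
    ← HomologicalComplex.exactAt_iff_isZero_homology] at h
  rw [HomologicalComplex.exactAt_iff' _ 0 0 1 (by simp) (by simp)] at h
  rw [ShortComplex.moduleCat_exact_iff] at h
  let p : P.complex.X 0 ⟶ M := P.π.f 0
  have hp : P.complex.d 1 0 ≫ p = 0 := P.complex_d_comp_π_f_zero
  have hep : Epi p := inferInstanceAs (Epi (P.π.f 0))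
  obtain ⟨g, hg⟩ := h (p ≫ f) (by
    change P.complex.d 1 0 ≫ p ≫ f = 0
    rw [← Category.assoc, hp, Limits.zero_comp])
  have h1 : p ≫ f = 0 := by
    rw [← hg]
    have h2 : ∀ g : P.complex.X 0 ⟶ N, P.complex.d 0 0 ≫ g = 0 := fun g => by
      rw [P.complex.shape 0 0 (by simp), Limits.zero_comp]
    exact h2 g
  rw [← cancel_epi p, h1, Limits.comp_zero]

lemma tor_sub_iff (i : ℕ) (M Y : ModuleCat.{0} R) (P : ProjectiveResolution Y) :
    Subsingleton (tor R (i+1) M Y) ↔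
     Function.Exact (LinearMap.lTensor M (P.complex.d (i+2) (i+1)).hom)
       (LinearMap.lTensor M (P.complex.d (i+1) i).hom) := by
  have e := P.isoLeftDerivedObj (MonoidalCategory.tensorLeft M) (i+1)
  rw [show tor R (i+1) M Y = ((MonoidalCategory.tensorLeft M).leftDerived (i+1)).obj Y from rfl]
  rw [e.toLinearEquiv.toEquiv.subsingleton_congr]
  erw [← ModuleCat.isZero_iff_subsingleton,
    ← HomologicalComplex.exactAt_iff_isZero_homology]
  rw [HomologicalComplex.exactAt_iff' _ (i+2) (i+1) i (by simp) (by simp)]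
  rw [ShortComplex.ShortExact.moduleCat_exact_iff_function_exact]
  rfl
end helpers

section hull

open IsLocalRing

lemma exists_hull (R : Type) [CommRing R] [IsLocalRing R] :
    ∃ (E : ModuleCat.{0} R) (e₀ : E), Module.Injective R E ∧ e₀ ≠ 0 ∧
      (∀ r ∈ maximalIdeal R, r • e₀ = 0) ∧
      (∀ e : E, (∀ r ∈ maximalIdeal R, r • e = 0) → ∃ r : R, e = r • e₀) := by
  let k := ModuleCat.of R (ResidueField R)
  let E0 : ModuleCat.{0} R := Injective.under k
  have hE0 : Module.Injective R E0 :=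
    (Module.injective_iff_injective_object R E0).2 (inferInstanceAs (Injective (Injective.under k)))
  let ι : k →ₗ[R] E0 := (Injective.ι k).hom
  have hι : Function.Injective ι := (ModuleCat.mono_iff_injective (Injective.ι k)).1 inferInstance
  let a : E0 := ι (1 : ResidueField R)
  have ha : a ≠ 0 := by
    intro h
    have := hι (h.trans (map_zero ι).symm)
    exact one_ne_zero (α := ResidueField R) this
  have ham : ∀ r ∈ maximalIdeal R, r • a = 0 := by
    intro r hr
    have : r • (1 : ResidueField R) = 0 := by
      rw [Algebra.smul_def, mul_one]
      exact (residue_eq_zero_iff r).2 hr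
    change r • ι (1 : ResidueField R) = 0
    rw [← map_smul]
    exact (congrArg ι this).trans (map_zero ι)
  let K : Submodule R E0 := Submodule.span R {a}
  let S : Set (Submodule R E0) := {E | K ≤ E ∧ ∀ x ∈ E, x ≠ 0 → ∃ r : R, r • x ∈ K ∧ r • x ≠ 0}
  obtain ⟨E, hKE, hEmax⟩ : ∃ E, K ≤ E ∧ Maximal (· ∈ S) E := by
    refine zorn_le_nonempty₀ S ?_ K ⟨le_rfl, fun x hx h0 => ⟨1, by simpa using hx, by simpa using h0⟩⟩
    intro c hc hchain y hy
    refine ⟨sSup c, ⟨(hc hy).1.trans (le_sSup hy), ?_⟩, fun z hz => le_sSup hz⟩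
    intro x hx h0
    rw [Submodule.mem_sSup_of_directed ⟨y, hy⟩ hchain.directedOn] at hx
    obtain ⟨z, hz, hxz⟩ := hx
    exact (hc hz).2 x hxz h0
  have hES := hEmax.prop
  obtain ⟨C, -, hCmax⟩ : ∃ C, ⊥ ≤ C ∧ Maximal (fun C : Submodule R E0 => Disjoint C E) C := by
    refine zorn_le_nonempty₀ {C : Submodule R E0 | Disjoint C E} ?_ ⊥ disjoint_bot_left
    intro c hc hchain y hy
    refine ⟨sSup c, ?_, fun z hz => le_sSup hz⟩
    change Disjoint _ _
    rw [Submodule.disjoint_def]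
    intro x hx hxE
    rw [Submodule.mem_sSup_of_directed ⟨y, hy⟩ hchain.directedOn] at hx
    obtain ⟨z, hz, hxz⟩ := hx
    exact Submodule.disjoint_def.1 (hc hz) x hxz hxE
  have hdis := Submodule.disjoint_def.1 hCmax.prop
  have hess : ∀ y : E0, y ∉ C → ∃ r : R, ∃ e ∈ E, e ≠ 0 ∧ r • C.mkQ y = C.mkQ e := by
    intro y hy
    by_contra hcon
    push Not at hcon
    have h1 : Disjoint (C ⊔ Submodule.span R {y}) E := by
      rw [Submodule.disjoint_def]
      intro x hx hxE
      obtain ⟨c, hc, z, hz, rfl⟩ := Submodule.mem_sup.1 hx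
      obtain ⟨r, rfl⟩ := Submodule.mem_span_singleton.1 hz
      by_contra hne
      refine hcon r _ hxE hne ?_
      rw [map_add, map_smul, (Submodule.Quotient.mk_eq_zero C).2 hc |> (show C.mkQ c = 0 from ·),
        zero_add]
    have := hCmax.le_of_ge h1 le_sup_left
    exact hy (this (le_sup_right (a := C) (Submodule.mem_span_singleton_self y)))
  obtain ⟨g, hg⟩ := hE0.out (C.mkQ ∘ₗ E.subtype) (by
    rw [← LinearMap.ker_eq_bot, LinearMap.ker_eq_bot']
    intro x hx
    have : (x : E0) ∈ C := by simpa using hx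
    exact Subtype.ext (hdis x this x.2)) E.subtype
  have hg' : ∀ e ∈ E, g (C.mkQ e) = e := fun e he => hg ⟨e, he⟩
  have hrange : LinearMap.range g ∈ S := by
    refine ⟨hKE.trans fun e he => ⟨C.mkQ e, hg' e he⟩, ?_⟩
    rintro _ ⟨q, rfl⟩ h0
    obtain ⟨y, rfl⟩ := C.mkQ_surjective q
    have hy : y ∉ C := fun hy => h0 (by
      rw [show C.mkQ y = 0 from (Submodule.Quotient.mk_eq_zero C).2 hy, map_zero])
    obtain ⟨r, e, he, hne, hre⟩ := hess y hy
    obtain ⟨s, hs, hs0⟩ := hES.2 e he hne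
    have : (s * r) • g (C.mkQ y) = s • e := by
      rw [mul_smul, ← map_smul, hre, hg' e he]
    exact ⟨s * r, by rwa [this], by rwa [this]⟩
  have hle : LinearMap.range g ≤ E :=
    hEmax.le_of_ge hrange fun e he => ⟨C.mkQ e, hg' e he⟩
  let ρ : E0 →ₗ[R] E := (g ∘ₗ C.mkQ).codRestrict E fun x => hle ⟨_, rfl⟩
  have hρ : ∀ e : E, ρ e = e := fun e => Subtype.ext (hg' e e.2)
  refine ⟨ModuleCat.of R E, ⟨a, hKE (Submodule.mem_span_singleton_self a)⟩, ?_, ?_, ?_, ?_⟩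
  · constructor
    intro X Y _ _ _ _ f hf h
    obtain ⟨h', hh'⟩ := hE0.out f hf (E.subtype ∘ₗ h)
    refine ⟨ρ ∘ₗ h', fun x => ?_⟩
    rw [LinearMap.comp_apply, hh']
    exact hρ (h x)
  · exact fun h => ha (congrArg Subtype.val h)
  · exact fun r hr => Subtype.ext (ham r hr)
  · rintro ⟨e, he⟩ hem
    by_cases h0 : e = 0
    · exact ⟨0, by rw [zero_smul]; exact Subtype.ext h0⟩
    obtain ⟨r, hrK, hr0⟩ := hES.2 e he h0
    have hu : IsUnit r := by
      by_contra hr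
      exact hr0 (congrArg Subtype.val (hem r ((mem_maximalIdeal r).2 hr)))
    obtain ⟨u, rfl⟩ := hu
    obtain ⟨s, hs⟩ := Submodule.mem_span_singleton.1 hrK
    refine ⟨(↑u⁻¹ : R) * s, Subtype.ext ?_⟩
    change e = ((↑u⁻¹ : R) * s) • a
    rw [mul_smul, hs, smul_smul, Units.inv_mul, one_smul]

variable {R : Type} [CommRing R] [IsLocalRing R] {E : ModuleCat.{0} R} [Module.Injective R E] {e₀ : E}

lemma hull_cogen (h0 : e₀ ≠ 0) (hm : ∀ r ∈ maximalIdeal R, r • e₀ = 0)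
    {X : Type} [AddCommGroup X] [Module R X] (x : X) (hx : x ≠ 0) : ∃ f : X →ₗ[R] E, f x ≠ 0 := by
  let φ : R →ₗ[R] X := LinearMap.toSpanSingleton R X x
  have hker : LinearMap.ker φ ≤ LinearMap.ker (LinearMap.toSpanSingleton R E e₀) := by
    intro r hr
    have hr' : r • x = 0 := by simpa [φ] using hr
    have : r ∈ maximalIdeal R := by
      intro hu
      exact hx ((hu.smul_eq_zero).1 hr')
    exact hm r this
  let ψ : (R ⧸ LinearMap.ker φ) →ₗ[R] E := (LinearMap.ker φ).liftQ _ hker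
  let φ' : (R ⧸ LinearMap.ker φ) →ₗ[R] X := (LinearMap.ker φ).liftQ φ le_rfl
  obtain ⟨f, hf⟩ := Module.Injective.out (Q := E) φ' (by
    rw [← LinearMap.ker_eq_bot]; exact Submodule.ker_liftQ_eq_bot _ _ _ le_rfl) ψ
  refine ⟨f, ?_⟩
  have := hf ((LinearMap.ker φ).mkQ 1)
  have h1 : φ' ((LinearMap.ker φ).mkQ 1) = x := one_smul R x
  have h2 : ψ ((LinearMap.ker φ).mkQ 1) = e₀ := one_smul R e₀
  rw [h1, h2] at this
  rwa [this]

lemma hull_length (hm : ∀ r ∈ maximalIdeal R, r • e₀ = 0)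
    (hs : ∀ e : E, (∀ r ∈ maximalIdeal R, r • e = 0) → ∃ r : R, e = r • e₀)
    {X : Type} [AddCommGroup X] [Module R X] (hX : IsFiniteLength R X) :
    Module.length R (X →ₗ[R] E) ≤ Module.length R X := by
  induction hX with
  | of_subsingleton => simp
  | @of_simple_quotient X _ _ N hsimp _ ih =>
    have h1 := Module.length_eq_add_of_exact N.subtype N.mkQ N.subtype_injective N.mkQ_surjective
      (LinearMap.exact_subtype_mkQ N)
    let α : (X ⧸ N →ₗ[R] E) →ₗ[R] (X →ₗ[R] E) := LinearMap.lcomp R E N.mkQ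
    let β : (X →ₗ[R] E) →ₗ[R] (N →ₗ[R] E) := LinearMap.lcomp R E N.subtype
    have h2 := Module.length_eq_add_of_exact α β.rangeRestrict
      (fun f g h => by
        refine LinearMap.ext fun q => ?_
        obtain ⟨y, rfl⟩ := N.mkQ_surjective q
        exact LinearMap.congr_fun h y)
      β.surjective_rangeRestrict
      (by
        intro f
        constructor
        · intro h
          have h' : ∀ n : N, f n = 0 := fun n =>
            LinearMap.congr_fun (congrArg Subtype.val h) n
          exact ⟨N.liftQ f fun n hn => h' ⟨n, hn⟩, LinearMap.ext fun x => rfl⟩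
        · rintro ⟨g, rfl⟩
          refine Subtype.ext (LinearMap.ext fun n => ?_)
          change g (N.mkQ n) = 0
          rw [show N.mkQ n = 0 from (Submodule.Quotient.mk_eq_zero N).2 n.2, map_zero])
    have h3 : Module.length R (LinearMap.range β) ≤ Module.length R N :=
      (Module.length_le_of_injective (LinearMap.range β).subtype
        (LinearMap.range β).subtype_injective).trans ih
    have h4 : Module.length R (X ⧸ N →ₗ[R] E) ≤ Module.length R (X ⧸ N) := by
      obtain ⟨I, hI, ⟨e⟩⟩ := isSimpleModule_iff_quot_maximal.mp hsimp
      obtain rfl := eq_maximalIdeal hI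
      let γ0 : (R ⧸ maximalIdeal R) →ₗ[R] E := Submodule.liftQ (maximalIdeal R)
        (LinearMap.toSpanSingleton R E e₀) (fun r hr => hm r hr)
      let γ : (X ⧸ N) →ₗ[R] E := γ0 ∘ₗ e.toLinearMap
      let δ : R →ₗ[R] (X ⧸ N →ₗ[R] E) := LinearMap.toSpanSingleton R _ γ
      have hδm : maximalIdeal R ≤ LinearMap.ker δ := by
        intro r hr
        refine LinearMap.ext fun q => ?_
        change r • γ q = 0
        obtain ⟨s, hs⟩ := Submodule.mkQ_surjective (maximalIdeal R) (e q)
        have : γ q = s • e₀ := by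
          change γ0 (e q) = _
          rw [← hs]; rfl
        rw [this, smul_comm, hm r hr, smul_zero]
      rw [e.length_eq]
      refine Module.length_le_of_surjective (Submodule.liftQ _ δ hδm) ?_
      intro f
      let q : X ⧸ N := e.symm (Submodule.mkQ _ 1)
      obtain ⟨r, hr⟩ := hs (f q) (fun r hr => by
        rw [← map_smul, ← map_smul, ← map_smul,
          show Submodule.mkQ (maximalIdeal R) (r • 1) = 0 from
            (Submodule.Quotient.mk_eq_zero _).2 (by simpa using hr), map_zero, map_zero])
      refine ⟨Submodule.mkQ _ r, LinearMap.ext fun p => ?_⟩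
      obtain ⟨s, hs⟩ := Submodule.mkQ_surjective (maximalIdeal R) (e p)
      have hp : p = s • q := by
        apply e.injective
        rw [map_smul, e.apply_symm_apply, ← map_smul, ← hs]; simp
      have hq : γ q = e₀ := by
        change γ0 (e (e.symm _)) = _
        rw [e.apply_symm_apply]
        change (1 : R) • e₀ = e₀
        simp
      change r • γ p = f p
      rw [hp, map_smul, map_smul, hq, hr, smul_comm]
    rw [h1, h2, add_comm]
    exact add_le_add h3 h4

lemma hull_dual (h0 : e₀ ≠ 0) (hm : ∀ r ∈ maximalIdeal R, r • e₀ = 0)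
    (hs : ∀ e : E, (∀ r ∈ maximalIdeal R, r • e = 0) → ∃ r : R, e = r • e₀)
    {X : Type} [AddCommGroup X] [Module R X] (hX : IsFiniteLength R X) :
    Module.Finite R (X →ₗ[R] E) ∧ Nonempty (X ≃ₗ[R] ((X →ₗ[R] E) →ₗ[R] E)) := by
  have l1 := hull_length hm hs hX
  have ht := Module.length_ne_top_iff.2 hX
  have hX' : IsFiniteLength R (X →ₗ[R] E) :=
    Module.length_ne_top_iff.1 (ne_top_of_le_ne_top ht l1)
  have l2 := (hull_length hm hs hX').trans l1
  constructor
  · have := (isFiniteLength_iff_isNoetherian_isArtinian.1 hX').1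
    infer_instance
  · let ev : X →ₗ[R] ((X →ₗ[R] E) →ₗ[R] E) := LinearMap.flip LinearMap.id
    have hinj : Function.Injective ev := by
      rw [← LinearMap.ker_eq_bot, LinearMap.ker_eq_bot']
      intro x hx
      by_contra hne
      obtain ⟨f, hf⟩ := hull_cogen (E := E) h0 hm x hne
      exact hf (LinearMap.congr_fun hx f)
    have h1 := Module.length_eq_add_of_exact ev (LinearMap.range ev).mkQ hinj
      (Submodule.mkQ_surjective _) (LinearMap.exact_map_mkQ_range ev)
    have h2 : Module.length R (_ ⧸ LinearMap.range ev) = 0 := by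
      rw [h1] at l2
      have l3 : Module.length R X + Module.length R (_ ⧸ LinearMap.range ev) ≤
          Module.length R X + 0 := by simpa using l2
      exact le_antisymm ((ENat.add_le_add_iff_left ht).1 l3) bot_le
    rw [Module.length_eq_zero_iff, Submodule.Quotient.subsingleton_iff,
      LinearMap.range_eq_top] at h2
    exact ⟨LinearEquiv.ofBijective ev ⟨hinj, h2⟩⟩

end hull

section duality

open CategoryTheory Abelian IsLocalRing

variable {R : Type} [CommRing R] {E : ModuleCat.{0} R} [hE : Module.Injective R E]

lemma dual_inj_of_proj (P : Type) [AddCommGroup P] [Module R P] [Module.Projective R P] :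
    Injective (ModuleCat.of R (P →ₗ[R] E)) := by
  rw [← Module.injective_iff_injective_object]
  constructor
  intro X Y _ _ _ _ f hf g
  obtain ⟨h, hh⟩ := hE.out (f.rTensor P) (Module.Flat.rTensor_preserves_injective_linearMap f hf)
    (TensorProduct.lift g)
  refine ⟨(TensorProduct.curry h : Y →ₗ[R] P →ₗ[R] E), fun x => LinearMap.ext fun p => ?_⟩
  have := hh (TensorProduct.tmul R x p)
  simpa using this

/-- The dual of the sequence `ker ε → P → Y`. -/
abbrev dualSC (E : ModuleCat.{0} R) {P Y : Type} [AddCommGroup P] [Module R P] [AddCommGroup Y]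
    [Module R Y] (ε : P →ₗ[R] Y) : ShortComplex (ModuleCat.{0} R) where
  X₁ := ModuleCat.of R (Y →ₗ[R] E)
  X₂ := ModuleCat.of R (P →ₗ[R] E)
  X₃ := ModuleCat.of R (LinearMap.ker ε →ₗ[R] E)
  f := ModuleCat.ofHom (LinearMap.lcomp R E ε)
  g := ModuleCat.ofHom (LinearMap.lcomp R E (LinearMap.ker ε).subtype)
  zero := by
    refine ModuleCat.hom_ext (LinearMap.ext fun (f : Y →ₗ[R] E) => LinearMap.ext fun x => ?_)
    change f (ε x) = 0
    rw [LinearMap.mem_ker.1 x.2, map_zero]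

lemma dualSC_shortExact {P Y : Type} [AddCommGroup P] [Module R P] [AddCommGroup Y]
    [Module R Y] (ε : P →ₗ[R] Y) (hε : Function.Surjective ε) : (dualSC E ε).ShortExact := by
  apply ModuleCat.shortComplex_shortExact
  · intro f
    constructor
    · intro h
      have h' : ∀ n : LinearMap.ker ε, f n = 0 := fun n => LinearMap.congr_fun h n
      let e := ε.quotKerEquivOfSurjective hε
      let f0 : (P ⧸ LinearMap.ker ε) →ₗ[R] E :=
        (LinearMap.ker ε).liftQ f (fun n hn => h' ⟨n, hn⟩)
      refine ⟨f0 ∘ₗ e.symm.toLinearMap, ?_⟩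
      refine LinearMap.ext fun x => ?_
      change f0 (e.symm (ε x)) = f x
      have : e.symm (ε x) = (LinearMap.ker ε).mkQ x := by
        rw [LinearEquiv.symm_apply_eq]; rfl
      rw [this]; rfl
    · rintro ⟨g, rfl⟩
      exact LinearMap.congr_fun (congrArg ModuleCat.Hom.hom (dualSC E ε).zero) g
  · intro f g h
    refine LinearMap.ext fun q => ?_
    obtain ⟨y, rfl⟩ := hε q
    exact LinearMap.congr_fun h y
  · intro f
    obtain ⟨g, hg⟩ := hE.out (LinearMap.ker ε).subtype (LinearMap.ker ε).subtype_injective f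
    exact ⟨g, LinearMap.ext hg⟩

lemma ext_tor [IsLocalRing R] {e₀ : E} (h0 : e₀ ≠ 0) (hm : ∀ r ∈ maximalIdeal R, r • e₀ = 0)
    (M : ModuleCat.{0} R) (i : ℕ) : ∀ (Y : Type) [AddCommGroup Y] [Module R Y]
      (P : ℕ → ModuleCat.{0} R) (_ : ∀ n, Module.Projective R (P n))
      (d : ∀ n, P (n+1) →ₗ[R] P n) (ε : P 0 →ₗ[R] Y) (_ : Function.Surjective ε)
      (_ : Function.Exact (d 0) ε) (_ : ∀ n, Function.Exact (d (n+1)) (d n))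
      (_ : Subsingleton (Abelian.Ext M (ModuleCat.of R (Y →ₗ[R] E)) (i+1))),
      Function.Exact (LinearMap.lTensor M (d (i+1))) (LinearMap.lTensor M (d i)) := by
  induction i with
  | zero =>
    intro Y _ _ P hP d ε hε h1 h2 hext
    have hS := dualSC_shortExact (E := E) ε hε
    let K := LinearMap.ker ε
    have hlift : ∀ f : M →ₗ[R] (K →ₗ[R] E), ∃ g : M →ₗ[R] (P 0 →ₗ[R] E),
        LinearMap.lcomp R E K.subtype ∘ₗ g = f := by
      intro f
      obtain ⟨x, hx⟩ := Abelian.Ext.covariant_sequence_exact₃ M hS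
        (Abelian.Ext.mk₀ (ModuleCat.ofHom f)) (zero_add 1) (Subsingleton.elim _ _)
      obtain ⟨g, rfl⟩ := Abelian.Ext.homEquiv₀.symm.surjective x
      have : Ext.mk₀ (g ≫ (dualSC E ε).g) = Ext.mk₀ (ModuleCat.ofHom f) := by
        rw [← hx]; simp [Abelian.Ext.homEquiv₀]
      have := (Ext.mk₀_bijective _ _).1 this
      exact ⟨g.hom, congrArg ModuleCat.Hom.hom this⟩
    have hinj : Function.Injective (LinearMap.lTensor M K.subtype) := by
      rw [← LinearMap.ker_eq_bot, LinearMap.ker_eq_bot']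
      intro t ht
      by_contra hne
      obtain ⟨f, hf⟩ := hull_cogen (E := E) h0 hm t hne
      obtain ⟨g, hg⟩ := hlift (TensorProduct.curry f)
      apply hf
      have : f = TensorProduct.lift g ∘ₗ LinearMap.lTensor M K.subtype := by
        refine TensorProduct.ext' fun m k => ?_
        have := LinearMap.congr_fun (LinearMap.congr_fun hg m) k
        simpa using this.symm
      rw [this, LinearMap.comp_apply, ht, map_zero]
    let ε' : P 1 →ₗ[R] K := (d 0).codRestrict K fun x => (h1 _).2 ⟨x, rfl⟩
    have hε' : Function.Surjective ε' := by
      rintro ⟨k, hk⟩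
      obtain ⟨x, hx⟩ := (h1 k).1 hk
      exact ⟨x, Subtype.ext hx⟩
    have hex' : Function.Exact (d 1) ε' := by
      intro x
      rw [← h2 0 x]
      exact ⟨fun h => congrArg Subtype.val h, fun h => Subtype.ext h⟩
    have := lTensor_exact M hex' hε'
    have hd : LinearMap.lTensor M (d 0) = LinearMap.lTensor M K.subtype ∘ₗ LinearMap.lTensor M ε' := by
      rw [← LinearMap.lTensor_comp]; rfl
    intro x
    rw [← this x, hd, LinearMap.comp_apply]
    exact ⟨fun h => hinj (h.trans (map_zero _).symm), fun h => by rw [h, map_zero]⟩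
  | succ i ih =>
    intro Y _ _ P hP d ε hε h1 h2 hext
    have hS := dualSC_shortExact (E := E) ε hε
    let K := LinearMap.ker ε
    let ε' : P 1 →ₗ[R] K := (d 0).codRestrict K fun x => (h1 _).2 ⟨x, rfl⟩
    have hε' : Function.Surjective ε' := by
      rintro ⟨k, hk⟩
      obtain ⟨x, hx⟩ := (h1 k).1 hk
      exact ⟨x, Subtype.ext hx⟩
    have hex' : Function.Exact (d 1) ε' := by
      intro x
      rw [← h2 0 x]
      exact ⟨fun h => congrArg Subtype.val h, fun h => Subtype.ext h⟩
    refine ih K (fun n => P (n+1)) (fun n => hP _) (fun n => d (n+1)) ε' hε' hex'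
      (fun n => h2 (n+1)) ?_
    refine subsingleton_of_forall_eq 0 fun x => ?_
    obtain ⟨y, rfl⟩ := Abelian.Ext.covariant_sequence_exact₃ M hS x rfl (Subsingleton.elim _ _)
    have : Injective (dualSC E ε).X₂ := by
      have := hP 0
      exact dual_inj_of_proj (P 0)
    rw [Abelian.Ext.eq_zero_of_injective y, Ext.zero_comp]

lemma dual_injDim (n : ℕ) : ∀ (Y : ModuleCat.{0} R), HasProjectiveDimensionLT Y n →
    HasInjectiveDimensionLT (ModuleCat.of R (Y →ₗ[R] E)) n := by
  have key : ∀ (Y : ModuleCat.{0} R), HasProjectiveDimensionLT Y 1 →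
    HasInjectiveDimensionLT (ModuleCat.of R (Y →ₗ[R] E)) 1 := by
    intro Y h
    have h1 : Projective Y := (projective_iff_hasProjectiveDimensionLT_one (X := Y)).2 h
    have h2 : Module.Projective R Y := (IsProjective.iff_projective Y).2 h1
    have := dual_inj_of_proj (E := E) Y
    infer_instance
  rcases n with _ | n
  · intro Y h
    have := isZero_of_hasProjectiveDimensionLT_zero Y
    have h1 := ModuleCat.isZero_iff_subsingleton.1 this
    apply Limits.IsZero.hasInjectiveDimensionLT_zero
    rw [ModuleCat.isZero_iff_subsingleton]
    change Subsingleton (Y →ₗ[R] E)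
    infer_instance
  induction n with
  | zero => exact key
  | succ n ih =>
    intro Y h
    let ε : ModuleCat.of R (Y →₀ R) →ₗ[R] Y := Finsupp.linearCombination R (id : Y → Y)
    have hε : Function.Surjective ε := Finsupp.linearCombination_id_surjective R Y
    have hproj : Module.Projective R (ModuleCat.of R (Y →₀ R)) :=
      inferInstanceAs (Module.Projective R (Y →₀ R))
    have hS := LinearMap.shortExact_shortComplexKer hε
    have h1 := (hS.hasProjectiveDimensionLT_X₃_iff n ((IsProjective.iff_projective _).1 hproj)).1 h
    exact ((dualSC_shortExact (E := E) ε hε).hasInjectiveDimensionLT_X₃_iff n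
      (dual_inj_of_proj _)).1 (ih _ h1)

end duality

section dimzero

open CategoryTheory Abelian IsLocalRing

variable {R : Type} [CommRing R]

lemma hasProjDim_of_projDim (Y : ModuleCat.{0} R) (h : projDim R Y ≠ ⊤) :
    ∃ n, HasProjectiveDimensionLT Y n := by
  unfold projDim at h
  rw [Ne, sInf_eq_top] at h
  push Not at h
  obtain ⟨n, hn, hn'⟩ := h
  lift n to ℕ using hn'
  refine ⟨n + 1, (hasProjectiveDimensionLT_iff _ _).2 fun i hi X e => ?_⟩
  obtain ⟨j, rfl⟩ : ∃ j, i = j + 1 := ⟨i - 1, by omega⟩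
  have := (ext_sub_iff j Y X).1 (hn (j+1) X (by exact_mod_cast hi))
  exact Subsingleton.elim _ _

lemma injDim_lt_top_of (N : ModuleCat.{0} R) (n : ℕ) [HasInjectiveDimensionLT N n] :
    injDim R N < ⊤ := by
  refine lt_of_le_of_lt (sInf_le (a := (n : ℕ∞)) ?_) (ENat.natCast_lt_top n)
  intro i X hi
  have hi' : n < i := by exact_mod_cast hi
  obtain ⟨j, rfl⟩ : ∃ j, i = j + 1 := ⟨i - 1, by omega⟩
  rw [ext_sub_iff]
  exact HasInjectiveDimensionLT.subsingleton N n _ hi'.le X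

lemma finiteLength_of_dim_zero [IsNoetherianRing R] (N : Type) [AddCommGroup N] [Module R N]
    [Module.Finite R N] (h : Module.supportDim R N ≤ 0) : IsFiniteLength R N := by
  rw [Module.supportDim_eq_ringKrullDim_quotient_annihilator] at h
  have h1 : Ring.KrullDimLE 0 (R ⧸ Module.annihilator R N) := by
    rw [Ring.krullDimLE_iff]; exact_mod_cast h
  have h2 : IsArtinianRing (R ⧸ Module.annihilator R N) := isArtinianRing_iff_krullDimLE_zero.2 h1
  let _ := Module.quotientAnnihilator (R := R) (M := N)
  have : IsScalarTower R (R ⧸ Module.annihilator R N) N :=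
    ⟨fun r s n => by
      obtain ⟨s, rfl⟩ := Ideal.Quotient.mk_surjective s
      change (r * s) • n = r • s • n
      rw [mul_smul]⟩
  have : Module.Finite (R ⧸ Module.annihilator R N) N :=
    Module.Finite.of_restrictScalars_finite R _ N
  have h3 : IsArtinian (R ⧸ Module.annihilator R N) N := inferInstance
  rw [isFiniteLength_iff_isNoetherian_isArtinian]
  refine ⟨inferInstance, ?_⟩
  exact isArtinian_of_surjective_algebraMap (S := R) (R := R ⧸ Module.annihilator R N)
    Ideal.Quotient.mk_surjective

lemma dim_zero_case [IsNoetherianRing R] [IsLocalRing R] (M N : ModuleCat.{0} R)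
    [Module.Finite R N] (htest : TestModule R M) (hdim : Module.supportDim R N ≤ 0)
    (i₀ : ℕ) (h : ∀ i, i₀ ≤ i → Subsingleton (Abelian.Ext M N i)) :
    ∃ n, HasInjectiveDimensionLT N n := by
  obtain ⟨E, e₀, hE, h0, hm, hs⟩ := exists_hull R
  have hfl := finiteLength_of_dim_zero N hdim
  obtain ⟨hfin, ⟨e⟩⟩ := hull_dual h0 hm hs hfl
  let Y : ModuleCat.{0} R := ModuleCat.of R (N →ₗ[R] E)
  have hY : Module.Finite R Y := hfin
  let eN : N ≅ ModuleCat.of R (Y →ₗ[R] E) := e.toModuleIso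
  have hpd : projDim R Y ≠ ⊤ := by
    intro htop
    refine htest Y hY htop (Set.Finite.subset (Set.finite_le_nat i₀) ?_)
    intro j hj
    by_contra hlt
    have hlt' : i₀ < j := not_le.1 hlt
    obtain ⟨i, rfl⟩ : ∃ i, j = i + 1 := ⟨j - 1, by omega⟩
    refine hj ?_
    let P := ProjectiveResolution.of Y
    rw [tor_sub_iff i M Y P]
    refine ext_tor h0 hm M i Y (fun n => P.complex.X n) 
      (fun n => (IsProjective.iff_projective _).2 (P.projective n))
      (fun n => (P.complex.d (n+1) n).hom) (P.π.f 0).hom ?_ ?_ ?_ ?_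
    · exact (ModuleCat.epi_iff_surjective (P.π.f 0)).1 inferInstance
    · have := P.exact₀
      rw [ShortComplex.ShortExact.moduleCat_exact_iff_function_exact] at this
      exact this
    · intro n
      have := P.exact_succ n
      rw [ShortComplex.ShortExact.moduleCat_exact_iff_function_exact] at this
      exact this
    · have h1 := h (i+1) hlt'.le
      refine subsingleton_of_forall_eq 0 fun x => ?_
      have h2 : x.comp (Ext.mk₀ eN.inv) (add_zero _) = 0 := Subsingleton.elim _ _
      have h3 : (x.comp (Ext.mk₀ eN.inv) (add_zero _)).comp (Ext.mk₀ eN.hom) (add_zero _) = x := by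
        simp
      rw [← h3, h2, Ext.zero_comp]
  obtain ⟨n, hn⟩ := hasProjDim_of_projDim Y hpd
  have := dual_injDim (E := E) n Y hn
  exact ⟨n, hasInjectiveDimensionLT_of_iso eN.symm n⟩

end dimzero

section induction_dim

open CategoryTheory Abelian IsLocalRing

variable {R : Type} [CommRing R]

lemma injDim_of_ideal (n : ℕ) : ∀ (N : ModuleCat.{0} R),
    (∀ I : Ideal R, Subsingleton (Abelian.Ext (ModuleCat.of R (R ⧸ I)) N (n+1))) →
    HasInjectiveDimensionLT N (n+1) := by
  induction n with
  | zero =>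
    intro N h
    have hB : Module.Baer R N := by
      intro I g
      let S : ShortComplex (ModuleCat.{0} R) :=
        { X₁ := ModuleCat.of R I
          X₂ := ModuleCat.of R R
          X₃ := ModuleCat.of R (R ⧸ I)
          f := ModuleCat.ofHom (Submodule.subtype I)
          g := ModuleCat.ofHom (Submodule.mkQ I)
          zero := ModuleCat.hom_ext (LinearMap.ext fun x =>
            (Submodule.Quotient.mk_eq_zero I).2 (Subtype.mem x)) }
      have hS : S.ShortExact := by
        apply ModuleCat.shortComplex_shortExact
        · exact LinearMap.exact_subtype_mkQ I
        · exact Submodule.subtype_injective I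
        · exact Submodule.mkQ_surjective I
      have := h I
      obtain ⟨x, hx⟩ := Abelian.Ext.contravariant_sequence_exact₁ hS N
        (Abelian.Ext.mk₀ (X := S.X₁) (ModuleCat.ofHom g)) (add_zero 1)
        ((h I).elim _ _)
      obtain ⟨g', rfl⟩ := Abelian.Ext.homEquiv₀.symm.surjective x
      have h1 : Ext.mk₀ (S.f ≫ g') = Ext.mk₀ (X := S.X₁) (ModuleCat.ofHom g) := by
        rw [← hx]; simp [Abelian.Ext.homEquiv₀]
      have h2 := (Ext.mk₀_bijective _ _).1 h1
      exact ⟨g'.hom, fun x hx => LinearMap.congr_fun (congrArg ModuleCat.Hom.hom h2) ⟨x, hx⟩⟩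
    have h1 := (Module.injective_iff_injective_object R N).1 hB.injective
    exact injective_iff_hasInjectiveDimensionLT_one.1 h1
  | succ n ih =>
    intro N h
    let S : ShortComplex (ModuleCat.{0} R) :=
      ShortComplex.mk _ _ (Limits.cokernel.condition (Injective.ι N))
    have hS : S.ShortExact := { exact := ShortComplex.exact_cokernel (Injective.ι N) }
    have hinj : Injective S.X₂ := inferInstanceAs (Injective (Injective.under N))
    refine (hS.hasInjectiveDimensionLT_X₃_iff n hinj).1 (ih _ fun I => ?_)
    refine subsingleton_of_forall_eq 0 fun x => ?_
    obtain ⟨y, rfl⟩ := Abelian.Ext.covariant_sequence_exact₃ _ hS x rfl ((h I).elim _ _)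
    rw [Abelian.Ext.eq_zero_of_injective y, Ext.zero_comp]

lemma main_induction [IsNoetherianRing R] [IsLocalRing R] (M : ModuleCat.{0} R)
    (htest : TestModule R M) (d : ℕ) : ∀ (N : ModuleCat.{0} R) (_ : Module.Finite R N)
    (_ : Module.supportDim R N ≤ d)
    (_ : ∀ i < d, Subsingleton (Abelian.Ext (ModuleCat.of R (ResidueField R)) N i))
    (i₀ : ℕ) (_ : ∀ i, i₀ ≤ i → Subsingleton (Abelian.Ext M N i)),
    ∃ n, HasInjectiveDimensionLT N n := by
  induction d with
  | zero =>
    intro N _ hdim _ i₀ h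
    exact dim_zero_case M N htest (by exact_mod_cast hdim) i₀ h
  | succ d ih =>
    intro N _ hdim hdep i₀ h
    let k := ModuleCat.of R (ResidueField R)
    have hhom : Subsingleton (ResidueField R →ₗ[R] N) := by
      have := hdep 0 (by omega)
      exact (Ext.linearEquiv₀ (R := R) (X := k) (Y := N) |>.trans
        ModuleCat.homLinearEquiv).symm.subsingleton
    obtain ⟨x, hxk, hx⟩ := IsSMulRegular.subsingleton_linearMap_iff.1 hhom
    have hxm : x ∈ maximalIdeal R := by
      rw [Module.mem_annihilator] at hxk
      have := hxk 1
      rw [Algebra.smul_def, mul_one] at this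
      exact (residue_eq_zero_iff x).1 this
    have hS := hx.smulShortComplex_shortExact
    let Q : ModuleCat.{0} R := (ModuleCat.smulShortComplex N x).X₃
    have hQfin : Module.Finite R Q := inferInstanceAs (Module.Finite R (QuotSMulTop x N))
    have hQdim : Module.supportDim R Q ≤ d := by
      have h1 := Module.supportDim_quotSMulTop_succ_eq_supportDim hx hxm
      rw [← h1] at hdim
      push_cast at hdim
      exact (ENat.WithBot.add_le_add_one_right_iff).1 hdim
    have hstep : ∀ (X : ModuleCat.{0} R) (i : ℕ), Subsingleton (Abelian.Ext X N i) →
        Subsingleton (Abelian.Ext X N (i+1)) → Subsingleton (Abelian.Ext X Q i) := by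
      intro X i h1 h2
      refine subsingleton_of_forall_eq 0 fun y => ?_
      obtain ⟨z, rfl⟩ := Abelian.Ext.covariant_sequence_exact₃ _ hS y rfl (h2.elim _ _)
      have hz : z = 0 := h1.elim z 0
      rw [hz, Ext.zero_comp]
    obtain ⟨n, hn⟩ := ih Q hQfin hQdim
      (fun i hi => hstep _ i (hdep i (by omega)) (hdep (i+1) (by omega))) i₀
      (fun i hi => hstep _ i (h i hi) (h (i+1) (by omega)))
    refine ⟨n+1, injDim_of_ideal n N fun I => ?_⟩
    let X := ModuleCat.of R (R ⧸ I)
    have hXfin : Module.Finite R X := inferInstanceAs (Module.Finite R (R ⧸ I))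
    have hfg : Module.Finite R (Abelian.Ext X N (n+1)) := inferInstance
    have hbot : (⊤ : Submodule R (Abelian.Ext X N (n+1))) = ⊥ := by
      refine Submodule.eq_bot_of_le_smul_of_le_jacobson_bot (maximalIdeal R) _ hfg.1 ?_
        (maximalIdeal_le_jacobson _)
      intro y _
      obtain ⟨z, rfl⟩ := Abelian.Ext.covariant_sequence_exact₂ X hS y
        (Abelian.Ext.eq_zero_of_hasInjectiveDimensionLT (X := Q) _ n (by omega))
      have : z.comp (Ext.mk₀ (ModuleCat.smulShortComplex N x).f) (add_zero _) = x • z := by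
        have hid : ∀ w : Abelian.Ext X N (n+1),
            w.comp (Ext.mk₀ (x • 𝟙 N)) (add_zero _) = x • w := by
          intro w
          rw [Ext.mk₀_smul, Ext.comp_smul, Ext.comp_mk₀_id]
        have hf : (ModuleCat.smulShortComplex N x).f = x • 𝟙 N :=
          ModuleCat.smulShortComplex_f_eq_smul_id N x
        exact (congrArg (fun g : N ⟶ N => Ext.comp z (Ext.mk₀ g) (add_zero (n+1))) hf).trans (hid z)
      rw [this]
      exact Submodule.smul_mem_smul hxm trivial
    exact (Submodule.subsingleton_iff R).1 (subsingleton_of_bot_eq_top hbot.symm)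

end induction_dim

/-- if `M` is a nonzero f.g. test module and `N` is a nonzero
f.g. Cohen-Macaulay module with `Ext^i_R(M,N) = 0` for all `i ≫ 0`, then
`id_R(N) < ∞`. -/
theorem stmt16 [IsNoetherianRing R] [IsLocalRing R]
    (M N : ModuleCat R) [Module.Finite R M] [Module.Finite R N]
    (hM : Nontrivial M) (hN : Nontrivial N)
    (htest : TestModule R M)
    (hCM : (depth R N : WithBot ℕ∞) = ringKrullDim (R ⧸ Module.annihilator R N))
    (h : ∃ i₀ : ℕ, ∀ i : ℕ, i₀ ≤ i → Subsingleton (ext R i M N)) :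
    injDim R N < ⊤ := by
  obtain ⟨i₀, h⟩ := h
  have hne : Module.annihilator R N ≠ ⊤ := by
    rw [Ne, Module.annihilator_eq_top_iff]
    exact not_subsingleton _
  have : Nontrivial (R ⧸ Module.annihilator R N) := Ideal.Quotient.nontrivial_iff.2 hne
  have : IsLocalRing (R ⧸ Module.annihilator R N) :=
    IsLocalRing.of_surjective' (Ideal.Quotient.mk _) Ideal.Quotient.mk_surjective
  have hdt : depth R N ≠ ⊤ := by
    intro ht
    rw [ht] at hCM
    exact ringKrullDim_ne_top hCM.symm
  obtain ⟨d, hd⟩ := ENat.ne_top_iff_exists.1 hdt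
  obtain ⟨n, hn⟩ := main_induction M htest d N inferInstance
    (by rw [Module.supportDim_eq_ringKrullDim_quotient_annihilator, ← hCM, ← hd]; rfl)
    (by
      intro i hi
      have h1 : Subsingleton (ext R i (ModuleCat.of R (IsLocalRing.ResidueField R)) N) := by
        by_contra hcon
        have : depth R N ≤ i := sInf_le ⟨i, rfl, hcon⟩
        rw [← hd] at this
        exact absurd (by exact_mod_cast this : d ≤ i) (not_le.2 hi)
      rcases i with _ | i
      · refine subsingleton_of_forall_eq 0 fun y => ?_
        obtain ⟨f, rfl⟩ := (Abelian.Ext.mk₀_bijective _ _).2 y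
        rw [ext_zero_sub _ _ h1 f, Abelian.Ext.mk₀_zero]
      · exact (ext_sub_iff _ _ _).1 h1)
    (i₀ + 1)
    (by
      intro i hi
      obtain ⟨j, rfl⟩ : ∃ j, i = j + 1 := ⟨i - 1, by omega⟩
      exact (ext_sub_iff _ _ _).1 (h _ (by omega)))
  exact injDim_lt_top_of N n
end
end

section
/- Let R be a commutative Noetherian ring and X a nonzero finitely generated R-module with Ext^1_R(X,R) = 0 such that X is reflexive, and suppose Ext^1_R(X*, R) = 0 as well, where X* = Hom_R(X,R). If there exist short exact sequences 0 → X* → F → X → 0 and 0 → X → G → X* → 0 with F, G finitely generated free, then Ext^i_R(X,R) = 0 for all i ≥ 1. -/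
open CategoryTheory

noncomputable section

variable (R : Type) [CommRing R]

/-- Vanishing of `Ext` in positive degree, read on a projective resolution. -/
lemma subsingleton_ext_iff_res {X : ModuleCat.{0} R} (Y : ModuleCat.{0} R)
    (P : ProjectiveResolution X) (n : ℕ) :
    Subsingleton (ext R (n + 1) X Y) ↔
      ∀ f : P.complex.X (n + 1) ⟶ Y, P.complex.d (n + 2) (n + 1) ≫ f = 0 →
        ∃ g : P.complex.X n ⟶ Y, P.complex.d (n + 1) n ≫ g = f := by
  have e := P.isoExt (R := R) (n + 1) Y
  rw [← ModuleCat.isZero_iff_subsingleton, e.isZero_iff,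
    ← HomologicalComplex.exactAt_iff_isZero_homology,
    HomologicalComplex.exactAt_iff' _ n (n + 1) (n + 2) (by simp) (by simp),
    ShortComplex.moduleCat_exact_iff]
  rfl

lemma subsingleton_ext_iff (X Y : ModuleCat.{0} R) (n : ℕ) :
    Subsingleton (ext R (n + 1) X Y) ↔ Subsingleton (Abelian.Ext X Y (n + 1)) := by
  let P := projectiveResolution X
  rw [subsingleton_ext_iff_res R Y P n]
  constructor
  · intro h
    refine subsingleton_of_forall_eq 0 fun α => ?_
    obtain ⟨f, hf, rfl⟩ := P.extMk_surjective α (n + 2) rfl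
    exact (P.extMk_eq_zero_iff f (n + 2) rfl hf n rfl).2 (h f hf)
  · intro h f hf
    exact (P.extMk_eq_zero_iff f (n + 2) rfl hf n rfl).1 (Subsingleton.elim _ _)

lemma ext_shift (A B F Y : ModuleCat.{0} R) [Module.Free R F]
    (f : A →ₗ[R] F) (g : F →ₗ[R] B)
    (hf : Function.Injective f) (hg : Function.Surjective g)
    (hfg : LinearMap.range f = LinearMap.ker g) (n : ℕ)
    (h : Subsingleton (ext R (n + 1) A Y)) : Subsingleton (ext R (n + 1 + 1) B Y) := by
  rw [subsingleton_ext_iff] at h ⊢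
  let S : ShortComplex (ModuleCat.{0} R) := ShortComplex.mk (ModuleCat.ofHom f) (ModuleCat.ofHom g) (by
    ext x
    have : f x ∈ LinearMap.ker g := hfg ▸ LinearMap.mem_range_self f x
    exact this)
  have hS : S.ShortExact :=
    { exact := by
        rw [ShortComplex.moduleCat_exact_iff]
        intro x hx
        have : x ∈ LinearMap.range f := hfg ▸ hx
        exact this
      mono_f := (ModuleCat.mono_iff_injective _).2 hf
      epi_g := (ModuleCat.epi_iff_surjective _).2 hg }
  have hP : Module.Projective R F := Module.Projective.of_free
  have : Projective S.X₂ := (IsProjective.iff_projective (R := R) F).1 hP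
  refine subsingleton_of_forall_eq 0 fun x => ?_
  obtain ⟨y, hy⟩ := Abelian.Ext.contravariant_sequence_exact₃ hS Y x
    (Abelian.Ext.eq_zero_of_projective _) (add_comm 1 (n + 1))
  have : y = 0 := h.elim _ _
  rw [← hy, this, Abelian.Ext.comp_zero]

lemma ext_shift_univ {F : Type*} [AddCommGroup F] [Module R F] [Module.Free R F]
    [Module.Finite R F] (A B Y : ModuleCat.{0} R)
    (f : A →ₗ[R] F) (g : F →ₗ[R] B)
    (hf : Function.Injective f) (hg : Function.Surjective g)
    (hfg : LinearMap.range f = LinearMap.ker g) (n : ℕ)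
    (h : Subsingleton (ext R (n + 1) A Y)) : Subsingleton (ext R (n + 1 + 1) B Y) := by
  let b := (Module.Free.chooseBasis R F).reindex (Fintype.equivFin _)
  let e := b.equivFun
  have hfree : Module.Free R (ModuleCat.of R
      (Fin (Fintype.card (Module.Free.ChooseBasisIndex R F)) → R)) :=
    inferInstanceAs (Module.Free R (Fin (Fintype.card (Module.Free.ChooseBasisIndex R F)) → R))
  refine ext_shift R A B (ModuleCat.of R
      (Fin (Fintype.card (Module.Free.ChooseBasisIndex R F)) → R)) Y
    (e.toLinearMap ∘ₗ f) (g ∘ₗ e.symm.toLinearMap)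
    (e.injective.comp hf) (hg.comp e.symm.surjective) ?_ n h
  ext x
  have hx : e.symm x ∈ LinearMap.range f ↔ e.symm x ∈ LinearMap.ker g := by rw [hfg]
  simp only [LinearMap.mem_range, LinearMap.mem_ker] at hx
  rw [LinearMap.mem_range, LinearMap.mem_ker]
  refine Iff.trans ?_ hx
  constructor
  · rintro ⟨y, rfl⟩
    exact ⟨y, (e.symm_apply_apply (f y)).symm⟩
  · rintro ⟨y, hy⟩
    exact ⟨y, (congrArg e hy).trans (e.apply_symm_apply x)⟩

/-- dimension shifting for a reflexive module `X` with
`Ext^1(X,R) = Ext^1(X*,R) = 0` sitting in exact sequences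
`0 → X* → F → X → 0` and `0 → X → G → X* → 0` with `F`, `G` f.g. free:
then `Ext^i(X,R) = 0` for all `i ≥ 1`. -/
theorem stmt17 [IsNoetherianRing R]
    (X : ModuleCat R) [Module.Finite R X] (hX : Nontrivial X)
    (hrefl : Module.IsReflexive R X)
    (h1 : Subsingleton (ext R 1 X (ModuleCat.of R R)))
    (h1d : Subsingleton (ext R 1 (ModuleCat.of R (X →ₗ[R] R)) (ModuleCat.of R R)))
    (hseq1 : ∃ (F : ModuleCat R), Module.Free R F ∧ Module.Finite R F ∧
      ∃ (f : (X →ₗ[R] R) →ₗ[R] F) (g : F →ₗ[R] X),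
        Function.Injective f ∧ Function.Surjective g ∧
        LinearMap.range f = LinearMap.ker g)
    (hseq2 : ∃ (G : ModuleCat R), Module.Free R G ∧ Module.Finite R G ∧
      ∃ (f : X →ₗ[R] G) (g : G →ₗ[R] (X →ₗ[R] R)),
        Function.Injective f ∧ Function.Surjective g ∧
        LinearMap.range f = LinearMap.ker g) :
    ∀ i : ℕ, 1 ≤ i → Subsingleton (ext R i X (ModuleCat.of R R)) := by
  obtain ⟨F, hF, hF2, f, g, hf, hg, hfg⟩ := hseq1
  obtain ⟨G, hG, hG2, f', g', hf', hg', hfg'⟩ := hseq2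
  have key : ∀ n : ℕ, Subsingleton (ext R (n + 1) X (ModuleCat.of R R)) ∧
      Subsingleton (ext R (n + 1) (ModuleCat.of R (X →ₗ[R] R)) (ModuleCat.of R R)) := by
    intro n
    induction n with
    | zero => exact ⟨h1, h1d⟩
    | succ n ih =>
      exact ⟨ext_shift_univ R (ModuleCat.of R (X →ₗ[R] R)) X _ f g hf hg hfg n ih.2,
        ext_shift_univ R X (ModuleCat.of R (X →ₗ[R] R)) _ f' g' hf' hg' hfg' n ih.1⟩
  intro i hi
  obtain ⟨n, rfl⟩ := Nat.exists_eq_add_of_le' hi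
  exact (key n).1
end
end

section
/- Let (R, m) be a commutative Noetherian local ring and suppose M is a finitely generated maximal Cohen-Macaulay strongly-rigid R-module, x ∈ m \ m² a non-zerodivisor on R. Then M/xM is a strongly-rigid module over R/xR. -/
open CategoryTheory

noncomputable section

variable (R : Type) [CommRing R]

variable {A : Type} [CommRing A]

lemma subs_tor_iff {M L : ModuleCat.{0} A} (P : ProjectiveResolution L) (n : ℕ) :
    Subsingleton (tor A (n+1) M L) ↔ Function.Exact
      ((P.complex.d (n+2) (n+1)).hom.lTensor M) ((P.complex.d (n+1) n).hom.lTensor M) := by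
  rw [← ModuleCat.isZero_iff_subsingleton]
  refine (P.isoLeftDerivedObj ((MonoidalCategory.tensoringLeft _).obj M) (n+1)).isZero_iff.trans ?_
  change Limits.IsZero (HomologicalComplex.homology _ _) ↔ _
  rw [← HomologicalComplex.exactAt_iff_isZero_homology, HomologicalComplex.exactAt_iff' _ (n+2) (n+1) n (by simp) (by simp), ShortComplex.ShortExact.moduleCat_exact_iff_function_exact]
  exact Iff.rfl

lemma subs_ext_iff {X L : ModuleCat.{0} A} (P : ProjectiveResolution L) (n : ℕ) :
    Subsingleton (ext A (n+1) L X) ↔ ∀ f : P.complex.X (n+1) ⟶ X, P.complex.d (n+2) (n+1) ≫ f = 0 →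
      ∃ g : P.complex.X n ⟶ X, P.complex.d (n+1) n ≫ g = f := by
  rw [← ModuleCat.isZero_iff_subsingleton, (P.isoExt (n+1) X).isZero_iff,
    ← HomologicalComplex.exactAt_iff_isZero_homology, HomologicalComplex.exactAt_iff' _ n (n+1) (n+2) (by simp) (by simp), ShortComplex.moduleCat_exact_iff]
  exact Iff.rfl

lemma exists_aug {L : ModuleCat.{0} A} (P : ProjectiveResolution L) :
    ∃ e : P.complex.X 0 ⟶ L, Function.Exact (P.complex.d 1 0).hom e.hom ∧ Function.Surjective e.hom := by
  refine ⟨P.π.f 0, ?_, ?_⟩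
  · have := P.exact₀
    rw [ShortComplex.ShortExact.moduleCat_exact_iff_function_exact] at this
    exact this
  · have : Epi (P.π.f 0) := inferInstance
    exact (ModuleCat.epi_iff_surjective _).1 this

lemma subs_ext_zero {X L : ModuleCat.{0} A} (h : Subsingleton (ext A 0 L X)) :
    Subsingleton (Abelian.Ext.{0} L X 0) := by
  let P := projectiveResolution L
  rw [← ModuleCat.isZero_iff_subsingleton, (P.isoExt 0 X).isZero_iff,
    ← HomologicalComplex.exactAt_iff_isZero_homology, HomologicalComplex.exactAt_iff' _ 0 0 1 (by simp) (by simp), ShortComplex.moduleCat_exact_iff] at h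
  rw [Abelian.Ext.addEquiv₀.subsingleton_congr]
  obtain ⟨e, he, hs⟩ := exists_aug P
  have h0 : P.complex.d 1 0 ≫ e = 0 := by
    ext v
    exact (he _).2 ⟨v, rfl⟩
  refine subsingleton_of_forall_eq 0 fun f => ?_
  have h1 : P.complex.d 1 0 ≫ (e ≫ f) = 0 := by rw [← Category.assoc, h0, Limits.zero_comp]
  obtain ⟨g, hg⟩ := h (e ≫ f) h1
  have h2 : (HomologicalComplex.sc' (P.complex.linearYonedaObj A X) 0 0 1).f = 0 :=
    (P.complex.linearYonedaObj A X).shape 0 0 (fun h => by cases h)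
  rw [h2] at hg
  have h3 : (0 : P.complex.X 0 ⟶ X) = e ≫ f := hg
  ext v
  obtain ⟨w, rfl⟩ := hs v
  exact (congrArg (fun (q : P.complex.X 0 ⟶ X) => q.hom w) h3).symm

lemma subs_ext_succ (X L : ModuleCat.{0} A) (n : ℕ) :
    Subsingleton (ext A (n+1) L X) ↔ Subsingleton (Abelian.Ext.{0} L X (n+1)) := by
  let P := projectiveResolution L
  rw [subs_ext_iff P]
  constructor
  · intro h
    refine subsingleton_of_forall_eq 0 fun a => ?_
    obtain ⟨f, hf, rfl⟩ := P.extMk_surjective a (n+2) rfl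
    exact (P.extMk_eq_zero_iff f (n+2) rfl hf n rfl).2 (h f hf)
  · intro h f hf
    exact (P.extMk_eq_zero_iff f (n+2) rfl hf n rfl).1 (Subsingleton.elim _ _)

lemma subs_ext_imp {X L : ModuleCat.{0} A} {n : ℕ} (h : Subsingleton (ext A n L X)) :
    Subsingleton (Abelian.Ext.{0} L X n) := by
  cases n with
  | zero => exact subs_ext_zero h
  | succ n => exact (subs_ext_succ X L n).1 h

lemma projDim_lt_top_iff (L : ModuleCat.{0} A) : projDim A L < ⊤ ↔ ∃ n, HasProjectiveDimensionLT L n := by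
  unfold projDim
  rw [sInf_lt_iff]
  constructor
  · rintro ⟨n, hn, h⟩
    lift n to ℕ using h.ne
    refine ⟨n+1, (hasProjectiveDimensionLT_iff L (n+1)).2 fun i hi Y e => ?_⟩
    have := subs_ext_imp (hn i Y (by exact_mod_cast hi))
    exact Subsingleton.elim _ _
  · rintro ⟨n, hn⟩
    refine ⟨n, fun i X hi => ?_, by simp⟩
    obtain ⟨i, rfl⟩ : ∃ j, i = j + 1 := ⟨i - 1, by have : n < i := by exact_mod_cast hi
                                                   omega⟩
    rw [subs_ext_succ]
    exact hn.subsingleton L n (i+1) (by exact_mod_cast hi.le) X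

/-- high Ext vanish implies Tor vanish -/
lemma tor_of_ext {L : ModuleCat.{0} A} (n : ℕ) (h : ∀ X, Subsingleton (ext A (n+1) L X)) (M : ModuleCat.{0} A) :
    Subsingleton (tor A (n+1) M L) := by
  let P := projectiveResolution L
  rw [subs_tor_iff P]
  have hX := (subs_ext_iff P n).1 (h (ModuleCat.of A (P.complex.X (n+1) ⧸ LinearMap.range (P.complex.d (n+2) (n+1)).hom))) (ModuleCat.ofHom (Submodule.mkQ _)) (by
    ext v
    simp)
  obtain ⟨g, hg⟩ := hX
  have hg' : g.hom ∘ₗ (P.complex.d (n+1) n).hom = Submodule.mkQ _ := congrArg ModuleCat.Hom.hom hg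
  intro z
  constructor
  · intro hz
    have h1 := lTensor_exact M (LinearMap.exact_map_mkQ_range (P.complex.d (n+2) (n+1)).hom) (Submodule.mkQ_surjective _)
    rw [← hg', LinearMap.lTensor_comp] at h1
    exact (h1 z).1 (by simp [hz])
  · rintro ⟨y, rfl⟩
    rw [← LinearMap.comp_apply, ← LinearMap.lTensor_comp, ← ModuleCat.hom_comp, P.complex.d_comp_d]
    simp
section chase
open TensorProduct

lemma chase_iff {K1 K0 F2 F1 F0 M2 M1 M0 : Type} [AddCommGroup K1] [AddCommGroup K0]
    [AddCommGroup F2] [AddCommGroup F1] [AddCommGroup F0]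
    [AddCommGroup M2] [AddCommGroup M1] [AddCommGroup M0]
    [Module A K1] [Module A K0] [Module A F2] [Module A F1] [Module A F0]
    [Module A M2] [Module A M1] [Module A M0]
    (dK : K1 →ₗ[A] K0) (dF2 : F2 →ₗ[A] F1) (dF1 : F1 →ₗ[A] F0) (dM2 : M2 →ₗ[A] M1) (dM1 : M1 →ₗ[A] M0)
    (i1 : K1 →ₗ[A] F1) (i0 : K0 →ₗ[A] F0) (p2 : F2 →ₗ[A] M2) (p1 : F1 →ₗ[A] M1) (p0 : F0 →ₗ[A] M0)
    (hi : ∀ k, i0 (dK k) = dF1 (i1 k)) (hp2 : ∀ k, p1 (dF2 k) = dM2 (p2 k)) (hp1 : ∀ k, p0 (dF1 k) = dM1 (p1 k))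
    (i0inj : Function.Injective i0) (e1 : Function.Exact i1 p1) (e0 : Function.Exact i0 p0)
    (s2 : Function.Surjective p2) (s1 : Function.Surjective p1) (eF : Function.Exact dF2 dF1) :
    Function.Exact dM2 dM1 ↔ ∀ k, (∃ f, dF1 f = i0 k) → ∃ k1, dK k1 = k := by
  constructor
  · rintro h k ⟨f, hf⟩
    obtain ⟨m, hm⟩ := (h (p1 f)).1 (by rw [← hp1, hf]; exact (e0 _).2 ⟨k, rfl⟩)
    obtain ⟨f2, rfl⟩ := s2 m
    obtain ⟨k1, hk1⟩ := (e1 (f - dF2 f2)).1 (by rw [map_sub, hp2, hm, sub_self])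
    refine ⟨k1, i0inj ?_⟩
    rw [hi, hk1, map_sub, hf, (eF _).2 ⟨f2, rfl⟩, sub_zero]
  · intro h m
    constructor
    · intro hm
      obtain ⟨f, rfl⟩ := s1 m
      rw [← hp1] at hm
      obtain ⟨k, hk⟩ := (e0 _).1 hm
      obtain ⟨k1, rfl⟩ := h k ⟨f, hk.symm⟩
      obtain ⟨f2, hf2⟩ := (eF (f - i1 k1)).1 (by rw [map_sub, ← hi, hk, sub_self])
      refine ⟨p2 f2, ?_⟩
      rw [← hp2, hf2, map_sub, (e1 _).2 ⟨k1, rfl⟩, sub_zero]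
    · rintro ⟨m2, rfl⟩
      obtain ⟨f2, rfl⟩ := s2 m2
      rw [← hp2, ← hp1, (eF _).2 ⟨f2, rfl⟩, map_zero]

variable {K F M : Type} [AddCommGroup K] [AddCommGroup F] [AddCommGroup M]
  [Module A K] [Module A F] [Module A M]
  {i : K →ₗ[A] F} {p : F →ₗ[A] M}

lemma comm_aux {K F U V : Type} [AddCommGroup K] [AddCommGroup F] [AddCommGroup U] [AddCommGroup V]
    [Module A K] [Module A F] [Module A U] [Module A V] (i : K →ₗ[A] F) (d : U →ₗ[A] V) (k : K ⊗[A] U) :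
    i.rTensor V (d.lTensor K k) = d.lTensor F (i.rTensor U k) := by
  rw [← LinearMap.comp_apply, ← LinearMap.comp_apply, LinearMap.rTensor_comp_lTensor, LinearMap.lTensor_comp_rTensor]

/-- abstract step -/
lemma chase_tensor {P2 P1 P0 : Type} [AddCommGroup P2] [AddCommGroup P1] [AddCommGroup P0]
    [Module A P2] [Module A P1] [Module A P0] [Module.Flat A P0] [Module.Flat A F]
    (hi : Function.Injective i) (he : Function.Exact i p) (hp : Function.Surjective p)
    (d2 : P2 →ₗ[A] P1) (d1 : P1 →ₗ[A] P0) (hd : Function.Exact d2 d1) :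
    Function.Exact (d2.lTensor M) (d1.lTensor M) ↔
      ∀ k, (∃ f, d1.lTensor F f = i.rTensor P0 k) → ∃ k1, d1.lTensor K k1 = k :=
  chase_iff (d1.lTensor K) (d2.lTensor F) (d1.lTensor F) (d2.lTensor M) (d1.lTensor M)
    (i.rTensor P1) (i.rTensor P0) (p.rTensor P2) (p.rTensor P1) (p.rTensor P0)
    (comm_aux i d1) (comm_aux p d2) (comm_aux p d1)
    (Module.Flat.rTensor_preserves_injective_linearMap i hi)
    (rTensor_exact P1 he hp) (rTensor_exact P0 he hp) (LinearMap.rTensor_surjective P2 hp)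
    (LinearMap.rTensor_surjective P1 hp) (Module.Flat.lTensor_exact F hd)

lemma inj_iff_of_cover {P1 P0 L : Type} [AddCommGroup L] [AddCommGroup P1] [AddCommGroup P0]
    [Module A L] [Module A P1] [Module A P0] (d1 : P1 →ₗ[A] P0) (e : P0 →ₗ[A] L)
    (hd : Function.Exact d1 e) (he : Function.Surjective e) :
    (∀ k, (∃ f, d1.lTensor F f = i.rTensor P0 k) → ∃ k1, d1.lTensor K k1 = k) ↔
      Function.Injective (i.rTensor L) := by
  have eF := lTensor_exact F hd he
  have eK := lTensor_exact K hd he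
  rw [injective_iff_map_eq_zero]
  constructor
  · intro h u hu
    obtain ⟨k, rfl⟩ := LinearMap.lTensor_surjective K he u
    rw [comm_aux] at hu
    exact (eK k).2 (h k ((eF _).1 hu))
  · intro h k hk
    refine (eK k).1 (h _ ?_)
    rw [comm_aux]
    exact (eF _).2 hk

lemma flat_X {L : ModuleCat.{0} A} (P : ProjectiveResolution L) (n : ℕ) : Module.Flat A (P.complex.X n) := by
  have := (IsProjective.iff_projective (R := A) (P.complex.X n)).2 (P.projective n)
  infer_instance

lemma exact_X {L : ModuleCat.{0} A} (P : ProjectiveResolution L) (n : ℕ) :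
    Function.Exact (P.complex.d (n+2) (n+1)).hom (P.complex.d (n+1) n).hom := by
  have := P.exact_succ n
  rw [ShortComplex.ShortExact.moduleCat_exact_iff_function_exact] at this
  exact this

variable {L : Type} [AddCommGroup L] [Module A L]

lemma tor_one_iff [Module.Flat A F]
    (hi : Function.Injective i) (he : Function.Exact i p) (hp : Function.Surjective p) :
    Subsingleton (tor A 1 (ModuleCat.of A M) (ModuleCat.of A L)) ↔ Function.Injective (i.rTensor L) := by
  let P := projectiveResolution (ModuleCat.of A L)
  have := flat_X P 0
  obtain ⟨e, h1, h2⟩ := exists_aug P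
  rw [subs_tor_iff P]
  exact (chase_tensor hi he hp _ _ (exact_X P 0)).trans (inj_iff_of_cover _ _ h1 h2)

lemma tor_shift [Module.Flat A F] (n : ℕ)
    (hi : Function.Injective i) (he : Function.Exact i p) (hp : Function.Surjective p) :
    Subsingleton (tor A (n+2) (ModuleCat.of A M) (ModuleCat.of A L)) ↔
      Subsingleton (tor A (n+1) (ModuleCat.of A K) (ModuleCat.of A L)) := by
  let P := projectiveResolution (ModuleCat.of A L)
  have := flat_X P (n+1)
  have := flat_X P n
  rw [subs_tor_iff P, subs_tor_iff P]
  refine (chase_tensor hi he hp _ _ (exact_X P (n+1))).trans ?_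
  have hF : Function.Exact ((P.complex.d (n+2) (n+1)).hom.lTensor F) ((P.complex.d (n+1) n).hom.lTensor F) :=
    Module.Flat.lTensor_exact F (exact_X P n)
  have hj := Module.Flat.rTensor_preserves_injective_linearMap (M := P.complex.X n) i hi
  have key : ∀ k : K ⊗[A] P.complex.X (n+1), (∃ f, (P.complex.d (n+2) (n+1)).hom.lTensor F f = i.rTensor _ k) ↔
      (P.complex.d (n+1) n).hom.lTensor K k = 0 := by
    intro k
    rw [← hj.eq_iff, comm_aux, map_zero]
    exact (hF _).symm
  constructor
  · intro h k
    refine ⟨fun hk => h k ((key k).2 hk), ?_⟩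
    rintro ⟨y, rfl⟩
    rw [← key]
    exact ⟨i.rTensor _ y, (comm_aux _ _ _).symm⟩
  · intro h k hk
    exact (h k).1 ((key k).1 hk)

variable (A M) in
lemma exists_cover : ∃ (F K : ModuleCat.{0} A) (i : K →ₗ[A] F) (p : F →ₗ[A] M), Module.Free A F ∧
    Function.Injective i ∧ Function.Exact i p ∧ Function.Surjective p :=
  ⟨ModuleCat.of A (M →₀ A),
    ModuleCat.of A (LinearMap.ker (Finsupp.linearCombination A (id : M → M))),
    (LinearMap.ker (Finsupp.linearCombination A (id : M → M))).subtype,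
    Finsupp.linearCombination A (id : M → M), Module.Free.finsupp A A M,
    Submodule.subtype_injective _, LinearMap.exact_subtype_ker_map _,
    Finsupp.linearCombination_id_surjective A M⟩

/-- symmetry of first Tor -/
lemma tor_one_symm_iff {N P : Type} [AddCommGroup N] [AddCommGroup P] [Module A N] [Module A P]
    [Module.Flat A P] {j : N →ₗ[A] P} {q : P →ₗ[A] L}
    (hj : Function.Injective j) (hjq : Function.Exact j q) (hq : Function.Surjective q) :
    Subsingleton (tor A 1 (ModuleCat.of A M) (ModuleCat.of A L)) ↔ Function.Injective (j.lTensor M) := by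
  obtain ⟨F, K, i, p, hF, hi, he, hp⟩ := exists_cover A M
  rw [tor_one_iff hi he hp, ← inj_iff_of_cover j q hjq hq]
  have h0 : Function.Exact (0 : PUnit.{1} →ₗ[A] N) j := by
    rw [LinearMap.exact_zero_iff_injective]
    exact hj
  rw [← chase_tensor hi he hp _ _ h0, LinearMap.lTensor_zero, LinearMap.exact_zero_iff_injective]

lemma tor_shift₂ (n : ℕ) {N P : Type} [AddCommGroup N] [AddCommGroup P] [Module A N] [Module A P]
    [Module.Flat A P] {j : N →ₗ[A] P} {q : P →ₗ[A] L}
    (hj : Function.Injective j) (hjq : Function.Exact j q) (hq : Function.Surjective q) :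
    Subsingleton (tor A (n+2) (ModuleCat.of A M) (ModuleCat.of A L)) ↔
      Subsingleton (tor A (n+1) (ModuleCat.of A M) (ModuleCat.of A N)) := by
  induction n generalizing M with
  | zero =>
    obtain ⟨F, K, i, p, hF, hi, he, hp⟩ := exists_cover A M
    rw [tor_shift 0 hi he hp, tor_one_symm_iff hj hjq hq, tor_one_iff hi he hp]
    have h1 := Module.Flat.rTensor_preserves_injective_linearMap (M := P) i hi
    have h2 := Module.Flat.lTensor_preserves_injective_linearMap (M := F) j hj
    rw [← h1.of_comp_iff, ← h2.of_comp_iff]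
    refine iff_of_eq (congrArg _ ?_)
    ext k
    exact comm_aux i j k
  | succ n ih =>
    obtain ⟨F, K, i, p, hF, hi, he, hp⟩ := exists_cover A M
    rw [tor_shift (n+1) hi he hp, tor_shift n hi he hp, ih]

/-- Tor over a local Noetherian ring detects finite projective dimension. -/
lemma projDim_of_tor [IsLocalRing A] [IsNoetherianRing A] [Module.Finite A L] (n : ℕ)
    (h : Subsingleton (tor A (n+1) (ModuleCat.of A (IsLocalRing.ResidueField A)) (ModuleCat.of A L))) :
    projDim A (ModuleCat.of A L) < ⊤ := by
  induction n generalizing L with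
  | zero =>
    obtain ⟨r, q, hq⟩ := Module.Finite.exists_fin' A L
    have hj := Submodule.subtype_injective (LinearMap.ker q)
    have he := LinearMap.exact_subtype_ker_map q
    rw [tor_one_symm_iff hj he hq] at h
    have := Module.free_of_lTensor_residueField_injective _ _ hq he h
    rw [projDim_lt_top_iff]
    have := (IsProjective.iff_projective (R := A) L).1 inferInstance
    exact ⟨1, projective_iff_hasProjectiveDimensionLT_one.1 this⟩
  | succ n ih =>
    obtain ⟨r, q, hq⟩ := Module.Finite.exists_fin' A L
    have hj := Submodule.subtype_injective (LinearMap.ker q)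
    have he := LinearMap.exact_subtype_ker_map q
    rw [tor_shift₂ n hj he hq] at h
    have h1 := ih h
    rw [projDim_lt_top_iff] at h1 ⊢
    obtain ⟨n, hn⟩ := h1
    have hS := LinearMap.shortExact_shortComplexKer hq
    have := (IsProjective.iff_projective (R := A) (Fin r → A)).1 inferInstance
    have h2 := projective_iff_hasProjectiveDimensionLT_one.1 this
    refine ⟨n+1, hS.hasProjectiveDimensionLT_X₃ n hn ?_⟩
    exact hasProjectiveDimensionLT_of_ge _ 1 _ (by omega)

end chase
section basechange
open TensorProduct

variable (x : A)

lemma one_tmul_eq_zero_iff {M : Type} [AddCommGroup M] [Module A M] (y : M) :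
    (1 : A ⧸ Ideal.span {x}) ⊗ₜ[A] y = 0 ↔ ∃ z, y = x • z := by
  rw [← (TensorProduct.quotTensorEquivQuotSMul M (Ideal.span {x})).map_eq_zero_iff,
    TensorProduct.quotTensorEquivQuotSMul_mk_one_tmul, Submodule.Quotient.mk_eq_zero,
    Submodule.ideal_span_singleton_smul]
  constructor
  · rintro ⟨z, -, hz⟩
    exact ⟨z, hz.symm⟩
  · rintro ⟨z, hz⟩
    exact ⟨z, trivial, hz.symm⟩

lemma baseChange_inj {K F M : Type} [AddCommGroup K] [AddCommGroup F] [AddCommGroup M]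
    [Module A K] [Module A F] [Module A M]
    {i : K →ₗ[A] F} {p : F →ₗ[A] M} (hi : Function.Injective i) (he : Function.Exact i p)
    (hM : IsSMulRegular M x) :
    Function.Injective (i.baseChange (A ⧸ Ideal.span {x})) := by
  rw [injective_iff_map_eq_zero]
  intro u hu
  obtain ⟨k, rfl⟩ : ∃ k, u = 1 ⊗ₜ k := by
    obtain ⟨k, rfl⟩ := (TensorProduct.quotTensorEquivQuotSMul K (Ideal.span {x})).symm.surjective u
    obtain ⟨k, rfl⟩ := Submodule.Quotient.mk_surjective _ k
    exact ⟨k, rfl⟩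
  rw [LinearMap.baseChange_tmul, one_tmul_eq_zero_iff] at hu
  obtain ⟨f, hf⟩ := hu
  have h1 : x • p f = x • 0 := by
    rw [← map_smul, ← hf, (he _).2 ⟨k, rfl⟩, smul_zero]
  obtain ⟨k', rfl⟩ := (he _).1 (hM h1)
  rw [one_tmul_eq_zero_iff]
  exact ⟨k', hi (by rw [hf, map_smul])⟩

variable {x} {L : Type} [AddCommGroup L] [Module A L] [Module (A ⧸ Ideal.span {x}) L]
  [IsScalarTower A (A ⧸ Ideal.span {x}) L]

variable (L) in
lemma tor_baseChange (hx : x ∈ nonZeroDivisors A) (n : ℕ) {M : Type} [AddCommGroup M] [Module A M]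
    (hM : IsSMulRegular M x) :
    Subsingleton (tor A (n+1) (ModuleCat.of A M) (ModuleCat.of A L)) ↔
    Subsingleton (tor (A ⧸ Ideal.span {x}) (n+1)
      (ModuleCat.of (A ⧸ Ideal.span {x}) ((A ⧸ Ideal.span {x}) ⊗[A] M)) (ModuleCat.of (A ⧸ Ideal.span {x}) L)) := by
  induction n generalizing M with
  | zero =>
    obtain ⟨F, K, i, p, hF, hi, he, hp⟩ := exists_cover A M
    have hi' := baseChange_inj x hi he hM
    have he' : Function.Exact (i.baseChange (A ⧸ Ideal.span {x})) (p.baseChange (A ⧸ Ideal.span {x})) :=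
      lTensor_exact _ he hp
    have hp' : Function.Surjective (p.baseChange (A ⧸ Ideal.span {x})) := LinearMap.lTensor_surjective _ hp
    rw [tor_one_iff hi he hp, tor_one_iff hi' he' hp', ← LinearMap.lTensor_inj_iff_rTensor_inj,
      ← LinearMap.lTensor_inj_iff_rTensor_inj]
    let eK := AlgebraTensorModule.cancelBaseChange A (A ⧸ Ideal.span {x}) (A ⧸ Ideal.span {x}) L K
    let eF := AlgebraTensorModule.cancelBaseChange A (A ⧸ Ideal.span {x}) (A ⧸ Ideal.span {x}) L F
    have key : ∀ z, i.lTensor L (eK z) = eF ((i.baseChange (A ⧸ Ideal.span {x})).lTensor L z) := by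
      intro z
      induction z using TensorProduct.induction_on with
      | zero => simp
      | add a b ha hb => simp only [map_add, ha, hb]
      | tmul l w =>
        induction w using TensorProduct.induction_on with
        | zero => simp
        | add a b ha hb => simp only [map_add, tmul_add, ha, hb]
        | tmul s k => simp [eK, eF]
    have key' : i.lTensor L ∘ eK = eF ∘ (i.baseChange (A ⧸ Ideal.span {x})).lTensor L := funext key
    rw [← eF.injective.of_comp_iff, ← key', EquivLike.injective_comp]
  | succ n ih =>
    obtain ⟨F, K, i, p, hF, hi, he, hp⟩ := exists_cover A M
    have hi' := baseChange_inj x hi he hM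
    have he' : Function.Exact (i.baseChange (A ⧸ Ideal.span {x})) (p.baseChange (A ⧸ Ideal.span {x})) :=
      lTensor_exact _ he hp
    have hp' : Function.Surjective (p.baseChange (A ⧸ Ideal.span {x})) := LinearMap.lTensor_surjective _ hp
    have hFx : IsSMulRegular F x := Module.Flat.isSMulRegular_of_nonZeroDivisors hx
    have hKx : IsSMulRegular K x := fun a b hab => hi (hFx (by simpa using congrArg i hab))
    rw [tor_shift n hi he hp, tor_shift n hi' he' hp', ih hKx]

lemma tor_retract {B : Type} [CommRing B] {M N L : ModuleCat.{0} B} (n : ℕ) (r : Retract M N)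
    (h : Subsingleton (tor B n N L)) : Subsingleton (tor B n M L) := by
  rw [← ModuleCat.isZero_iff_subsingleton] at h ⊢
  exact Limits.IsZero.of_mono (((Tor _ n).map r.i).app L) h

end basechange
section regular

lemma length_le_coheight {A : Type} [CommRing A] [IsLocalRing A] [IsNoetherianRing A] (rs : List A) {M : Type}
    [AddCommGroup M] [Module A M] [Module.Finite A M]
    (hrs : ∀ r ∈ rs, r ∈ IsLocalRing.maximalIdeal A)
    (hreg : RingTheory.Sequence.IsWeaklyRegular M rs) (p : PrimeSpectrum A)
    (hp : IsAssociatedPrime p.asIdeal M) : (rs.length : ℕ∞) ≤ Order.coheight p := by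
  induction rs generalizing M p with
  | nil => simp
  | cons a rs ih =>
    rw [RingTheory.Sequence.isWeaklyRegular_cons_iff] at hreg
    obtain ⟨ha, hrs'⟩ := hreg
    obtain ⟨-, m, hm⟩ := isAssociatedPrime_iff.1 hp
    have hmem : ∀ r, r ∈ p.asIdeal ↔ r • m = 0 := fun r => by
      rw [hm, Submodule.mem_colon_singleton, Submodule.mem_bot]
    have hm0 : m ≠ 0 := by
      rintro rfl
      exact p.2.ne_top ((Ideal.eq_top_iff_one _).2 ((hmem 1).2 (smul_zero _)))
    have hap : a ∉ p.asIdeal := fun h => hm0 (ha (by simpa using (hmem a).1 h))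
    let N := Submodule.torsionBySet A M (p.asIdeal : Set A)
    have hmN : m ∈ N := by
      rw [Submodule.mem_torsionBySet_iff]
      exact fun r => (hmem r).1 r.2
    obtain ⟨y, hyN, hya⟩ : ∃ y ∈ N, ∀ z, y ≠ a • z := by
      by_contra! hcon
      have hle : N ≤ Ideal.span {a} • N := by
        intro y hy
        obtain ⟨z, rfl⟩ := hcon y hy
        rw [Submodule.ideal_span_singleton_smul]
        refine Submodule.smul_mem_pointwise_smul _ _ _ ?_
        rw [Submodule.mem_torsionBySet_iff] at hy ⊢
        intro r
        refine ha ?_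
        have := hy r
        change a • (r : A) • z = a • 0
        rw [smul_comm, smul_zero]
        exact this
      have hbot := Submodule.eq_bot_of_le_smul_of_le_jacobson_bot _ N (IsNoetherian.noetherian N) hle (by
        rw [IsLocalRing.jacobson_eq_maximalIdeal _ bot_ne_top, Ideal.span_singleton_le_iff_mem]
        exact hrs a (by simp))
      rw [hbot] at hmN
      exact hm0 hmN
    let y' : QuotSMulTop a M := Submodule.Quotient.mk y
    have hy' : y' ≠ 0 := by
      intro h
      rw [Submodule.Quotient.mk_eq_zero] at h
      obtain ⟨z, -, hz⟩ := h
      exact hya z hz.symm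
    obtain ⟨Q, hQ, hle⟩ := exists_le_isAssociatedPrime_of_isNoetherianRing A y' hy'
    have haQ : a ∈ Q := hle (by
      rw [Submodule.mem_colon_singleton, Submodule.mem_bot, ← Submodule.Quotient.mk_smul,
        Submodule.Quotient.mk_eq_zero]
      exact Submodule.smul_mem_pointwise_smul _ _ _ trivial)
    have hpQ : p.asIdeal ≤ Q := fun r hr => hle (by
      rw [Submodule.mem_colon_singleton, Submodule.mem_bot, ← Submodule.Quotient.mk_smul]
      rw [Submodule.mem_torsionBySet_iff] at hyN
      have := hyN ⟨r, hr⟩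
      change r • y = 0 at this
      rw [this, Submodule.Quotient.mk_zero])
    let q : PrimeSpectrum A := ⟨Q, hQ.1⟩
    have hlt : p < q := lt_of_le_of_ne hpQ (fun h => hap (by rw [h]; exact haQ))
    have h1 := ih (M := QuotSMulTop a M) (fun r hr => hrs r (by simp [hr])) hrs' q hQ
    refine le_trans ?_ (Order.coheight_add_one_le hlt)
    rw [List.length_cons, Nat.cast_succ]
    gcongr

lemma isSMulRegular_of_mcm [IsNoetherianRing A] [IsLocalRing A]
    (M : ModuleCat.{0} A) [Module.Finite A M] (hM : Nontrivial M)
    (hmcm : (depth A M : WithBot ℕ∞) = ringKrullDim A)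
    (x : A) (hreg : x ∈ nonZeroDivisors A) : IsSMulRegular M x := by
  have hfin : depth A M < ⊤ := by
    have h := ringKrullDim_lt_top (R := A)
    rw [← hmcm] at h
    exact WithBot.coe_lt_coe.1 h
  obtain ⟨d, hd⟩ := ENat.ne_top_iff_exists.1 hfin.ne
  have hext : ∀ i < d, Subsingleton (Abelian.Ext.{0} (ModuleCat.of A (IsLocalRing.ResidueField A)) M i) := by
    intro i hi
    apply subs_ext_imp
    by_contra hcon
    have : depth A M ≤ i := sInf_le ⟨i, rfl, hcon⟩
    rw [← hd] at this
    exact absurd (by exact_mod_cast this) (not_le.2 hi)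
  obtain ⟨rs, hlen, hrs, hr⟩ := ModuleCat.exists_isRegular_of_exists_subsingleton_ext
    (IsLocalRing.maximalIdeal A) d M (by
      rw [lt_top_iff_ne_top]
      intro h
      have := Submodule.eq_bot_of_le_smul_of_le_jacobson_bot (IsLocalRing.maximalIdeal A)
        (⊤ : Submodule A M) (Module.Finite.fg_top) h.ge
        (by rw [IsLocalRing.jacobson_eq_maximalIdeal _ bot_ne_top])
      exact top_ne_bot this)
    (ModuleCat.of A (IsLocalRing.ResidueField A)) (by
      rw [Module.support_eq_zeroLocus]
      change PrimeSpectrum.zeroLocus ((Module.annihilator A (A ⧸ IsLocalRing.maximalIdeal A) : Ideal A) : Set A) = _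
      rw [Ideal.annihilator_quotient]) hext
  by_contra hx
  have hx' : ∃ m : M, m ≠ 0 ∧ x • m = 0 := by
    by_contra! hcon
    refine hx fun a b hab => ?_
    by_contra hne
    exact hcon (a - b) (sub_ne_zero.2 hne) (by
      change x • a = x • b at hab
      rw [smul_sub, hab, sub_self])
  have hx2 : x ∈ ⋃ p ∈ associatedPrimes A M, (p : Set A) := by
    rw [biUnion_associatedPrimes_eq_zero_divisors]; exact hx'
  simp only [Set.mem_iUnion] at hx2
  obtain ⟨P, hP, hxP⟩ := hx2
  have := hP.1
  obtain ⟨Q, hQ, hQP⟩ := Ideal.exists_minimalPrimes_le (bot_le : ⊥ ≤ P)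
  have hxQ : x ∉ Q := fun h => Set.disjoint_left.1 (Ideal.disjoint_nonZeroDivisors_of_mem_minimalPrimes hQ) h hreg
  let p : PrimeSpectrum A := ⟨P, hP.1⟩
  let q : PrimeSpectrum A := ⟨Q, hQ.1.1⟩
  have hlt : q < p := lt_of_le_of_ne hQP (fun h => hxQ (by
    have : Q = P := congrArg PrimeSpectrum.asIdeal h
    rw [this]; exact hxP))
  have h1 := length_le_coheight rs hrs hr.toIsWeaklyRegular p hP
  rw [hlen] at h1
  have h2 := Order.coheight_add_one_le hlt
  have h3 := Order.coheight_le_krullDim q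
  change _ ≤ ringKrullDim A at h3
  rw [← hmcm, ← hd] at h3
  have h4 : Order.coheight q ≤ d := by exact_mod_cast h3
  have h5 : (d : ℕ∞) + 1 ≤ d := le_trans (by gcongr) (h2.trans h4)
  have h6 : d + 1 ≤ d := by exact_mod_cast h5
  omega

end regular
section final
open TensorProduct IsLocalRing

lemma residue_retract [IsLocalRing A] (x : A) [IsLocalRing (A ⧸ Ideal.span {x})] (hx1 : x ∈ maximalIdeal A)
    (hx2 : x ∉ maximalIdeal A ^ 2) :
    Nonempty (Retract (ModuleCat.of (A ⧸ Ideal.span {x}) (ResidueField (A ⧸ Ideal.span {x})))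
      (ModuleCat.of (A ⧸ Ideal.span {x}) ((A ⧸ Ideal.span {x}) ⊗[A] (maximalIdeal A)))) := by
  have hsurj : Function.Surjective (algebraMap A (A ⧸ Ideal.span {x})) := Ideal.Quotient.mk_surjective
  have hloc : IsLocalHom (algebraMap A (A ⧸ Ideal.span {x})) := hsurj.isLocalHom _
  obtain ⟨f, hf⟩ := Module.Projective.exists_dual_eq_one (ResidueField A)
    (x := (maximalIdeal A).toCotangent ⟨x, hx1⟩) (by rw [Ne, Ideal.toCotangent_eq_zero]; exact hx2)
  let g : ResidueField A →ₗ[A] ResidueField (A ⧸ Ideal.span {x}) :=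
    Submodule.liftQ (maximalIdeal A) (Algebra.linearMap A (ResidueField (A ⧸ Ideal.span {x}))) (by
      intro r hr
      rw [LinearMap.mem_ker, Algebra.linearMap_apply,
        IsScalarTower.algebraMap_apply A (A ⧸ Ideal.span {x}) (ResidueField (A ⧸ Ideal.span {x})),
        ResidueField.algebraMap_eq, residue_eq_zero_iff]
      rw [mem_maximalIdeal, mem_nonunits_iff] at hr ⊢
      exact fun h => hr (isUnit_of_map_unit _ _ h))
  have hg : g 1 = 1 := by
    change g (Submodule.Quotient.mk 1) = 1
    exact (Submodule.liftQ_apply _ _ _).trans (by simp)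
  let φ0 : maximalIdeal A →ₗ[A] ResidueField (A ⧸ Ideal.span {x}) :=
    g ∘ₗ (f.restrictScalars A) ∘ₗ (maximalIdeal A).toCotangent
  have hφ0 : φ0 ⟨x, hx1⟩ = 1 := by
    simp only [φ0, LinearMap.comp_apply, LinearMap.restrictScalars_apply]
    rw [hf, hg]
  let φ := φ0.liftBaseChange (A ⧸ Ideal.span {x})
  have key : ∀ s ∈ maximalIdeal (A ⧸ Ideal.span {x}),
      s • ((1 : A ⧸ Ideal.span {x}) ⊗ₜ[A] (⟨x, hx1⟩ : maximalIdeal A)) = 0 := by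
    intro s hs
    obtain ⟨r, rfl⟩ := hsurj s
    have hr : r ∈ maximalIdeal A := by
      rw [mem_maximalIdeal, mem_nonunits_iff] at hs ⊢
      exact fun h => hs (h.map _)
    rw [algebraMap_smul, ← tmul_smul]
    rw [one_tmul_eq_zero_iff]
    exact ⟨⟨r, hr⟩, Subtype.ext (mul_comm _ _)⟩
  let ψ : ResidueField (A ⧸ Ideal.span {x}) →ₗ[A ⧸ Ideal.span {x}] (A ⧸ Ideal.span {x}) ⊗[A] (maximalIdeal A) :=
    Submodule.liftQ (maximalIdeal (A ⧸ Ideal.span {x}))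
      (LinearMap.toSpanSingleton (A ⧸ Ideal.span {x}) _
        ((1 : A ⧸ Ideal.span {x}) ⊗ₜ[A] (⟨x, hx1⟩ : maximalIdeal A)))
      (fun s hs => by rw [LinearMap.mem_ker, LinearMap.toSpanSingleton_apply]; exact key s hs)
  have hψ : ∀ s, ψ (residue _ s) = s • ((1 : A ⧸ Ideal.span {x}) ⊗ₜ[A] (⟨x, hx1⟩ : maximalIdeal A)) :=
    fun s => Submodule.liftQ_apply _ _ _
  refine ⟨⟨ModuleCat.ofHom ψ, ModuleCat.ofHom φ, ?_⟩⟩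
  rw [← ModuleCat.ofHom_comp, ← ModuleCat.ofHom_id]
  congr 1
  ext k
  obtain ⟨s, rfl⟩ := residue_surjective k
  rw [LinearMap.comp_apply, hψ, map_smul]
  simp only [φ, LinearMap.liftBaseChange_tmul, hφ0, one_smul, LinearMap.id_apply]
  rw [Algebra.smul_def, mul_one, ResidueField.algebraMap_eq]

lemma projDim_quot [IsLocalRing A] [IsNoetherianRing A] (x : A) [IsLocalRing (A ⧸ Ideal.span {x})]
    (hx1 : x ∈ maximalIdeal A) (hx2 : x ∉ maximalIdeal A ^ 2) (hx : x ∈ nonZeroDivisors A)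
    {L : Type} [AddCommGroup L] [Module A L] [Module (A ⧸ Ideal.span {x}) L]
    [IsScalarTower A (A ⧸ Ideal.span {x}) L] [Module.Finite (A ⧸ Ideal.span {x}) L]
    (h : projDim A (ModuleCat.of A L) < ⊤) :
    projDim (A ⧸ Ideal.span {x}) (ModuleCat.of (A ⧸ Ideal.span {x}) L) < ⊤ := by
  obtain ⟨N, hN, hlt⟩ := sInf_lt_iff.1 h
  obtain ⟨n, rfl⟩ := ENat.ne_top_iff_exists.1 hlt.ne
  have h1 : Subsingleton (tor A (n+2) (ModuleCat.of A (ResidueField (A ⧸ Ideal.span {x}))) (ModuleCat.of A L)) :=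
    tor_of_ext (n+1) (fun X => hN (n+2) X (by exact_mod_cast (by omega : n < n + 2))) _
  have hsurj : Function.Surjective (algebraMap A (A ⧸ Ideal.span {x})) := Ideal.Quotient.mk_surjective
  have hloc : IsLocalHom (algebraMap A (A ⧸ Ideal.span {x})) := hsurj.isLocalHom _
  have hp : Function.Surjective (Algebra.linearMap A (ResidueField (A ⧸ Ideal.span {x}))) := by
    intro k
    obtain ⟨s, rfl⟩ := residue_surjective k
    obtain ⟨r, rfl⟩ := hsurj s
    exact ⟨r, rfl⟩
  have he : Function.Exact (maximalIdeal A).subtype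
      (Algebra.linearMap A (ResidueField (A ⧸ Ideal.span {x}))) := by
    intro r
    rw [Algebra.linearMap_apply,
        IsScalarTower.algebraMap_apply A (A ⧸ Ideal.span {x}) (ResidueField (A ⧸ Ideal.span {x})),
        ResidueField.algebraMap_eq, residue_eq_zero_iff, mem_maximalIdeal, mem_nonunits_iff, isUnit_map_iff]
    constructor
    · intro hr
      exact ⟨⟨r, hr⟩, rfl⟩
    · rintro ⟨r, rfl⟩
      exact r.2
  rw [tor_shift n (Submodule.subtype_injective _) he hp] at h1
  have hreg : IsSMulRegular (maximalIdeal A) x := by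
    intro a b hab
    refine Subtype.ext ?_
    have := congrArg Subtype.val hab
    exact (Module.Flat.isSMulRegular_of_nonZeroDivisors (M := A) hx) this
  rw [tor_baseChange L hx n hreg] at h1
  obtain ⟨r⟩ := residue_retract x hx1 hx2
  exact projDim_of_tor n (tor_retract _ r h1)

end final

/-- if `M` is a maximal Cohen-Macaulay strongly-rigid module and
`x ∈ m \ m²` is a non-zerodivisor on `R`, then `M/xM` is strongly-rigid over
`R/xR`. -/
theorem stmt18 [IsNoetherianRing R] [IsLocalRing R]
    (M : ModuleCat R) [Module.Finite R M] (hM : Nontrivial M)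
    (hsr : StronglyRigid R M)
    (hmcm : (depth R M : WithBot ℕ∞) = ringKrullDim R)
    (x : R) (hx1 : x ∈ IsLocalRing.maximalIdeal R)
    (hx2 : x ∉ (IsLocalRing.maximalIdeal R) ^ 2)
    (hreg : x ∈ nonZeroDivisors R) :
    StronglyRigid (R ⧸ Ideal.span {x})
      (ModuleCat.of (R ⧸ Ideal.span {x})
        ((M : Type) ⧸ (Ideal.span {x} • (⊤ : Submodule R M)))) := by
  have hxM : IsSMulRegular M x := isSMulRegular_of_mcm M hM hmcm x hreg
  have hnt : Nontrivial (R ⧸ Ideal.span {x}) := by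
    rw [Ideal.Quotient.nontrivial_iff]
    exact fun h => (IsLocalRing.maximalIdeal.isMaximal R).ne_top
      (top_le_iff.1 (h ▸ (Ideal.span_singleton_le_iff_mem _).2 hx1))
  have hloc : IsLocalRing (R ⧸ Ideal.span {x}) :=
    IsLocalRing.of_surjective' (Ideal.Quotient.mk (Ideal.span {x})) Ideal.Quotient.mk_surjective
  intro X hX n hn h
  obtain ⟨n, rfl⟩ : ∃ k, n = k + 1 := ⟨n - 1, by omega⟩
  letI : Module R X := Module.compHom X (algebraMap R (R ⧸ Ideal.span {x}))
  haveI : IsScalarTower R (R ⧸ Ideal.span {x}) X := IsScalarTower.of_compHom _ _ _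
  have hXf : Module.Finite R X := Module.Finite.trans (R ⧸ Ideal.span {x}) X
  let e : ((M : Type) ⧸ (Ideal.span {x} • (⊤ : Submodule R M))) ≃ₗ[R ⧸ Ideal.span {x}]
      (TensorProduct R (R ⧸ Ideal.span {x}) M) :=
    LinearEquiv.extendScalarsOfSurjective Ideal.Quotient.mk_surjective
      (TensorProduct.quotTensorEquivQuotSMul M (Ideal.span {x})).symm
  have h1 := tor_retract _ (Retract.ofIso e.symm.toModuleIso) h
  have h2 := (tor_baseChange (X : Type) hreg n hxM).2 h1
  have h3 := hsr (ModuleCat.of R X) hXf (n+1) hn h2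
  exact projDim_quot x hx1 hx2 hreg h3
end
end
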